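/- Let F ∈ ℂ[X₀,X₁,X₂,X₃,X₄] be any homogeneous polynomial of degree 3. Then there exists a 6×6 matrix M whose entries are homogeneous linear forms in X₀,…,X₄ (ℂ-linear combinations of the variables), satisfying Mᵀ = −M, such that det M = F². (Equivalently, since M is skew-symmetric of even size, the cubic hypersurface {F = 0} ⊂ ℙ⁴ admits a Pfaffian representation Pf(M) = ±F.) -/

import Mathlib

namespace CubicPf

/-- explicit 3 by 3 determinant -/
def det3 (m : Fin 3 → Fin 3 → ℂ) : ℂ :=
  m 0 0 * (m 1 1 * m 2 2 - m 1 2 * m 2 1) - m 0 1 * (m 1 0 * m 2 2 - m 1 2 * m 2 0)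
    + m 0 2 * (m 1 0 * m 2 1 - m 1 1 * m 2 0)

/-- a function is Pfaffian -/
def IsPf {W : Type*} [AddCommGroup W] [Module ℂ W] (f : W → ℂ) : Prop :=
  ∃ (B : Fin 3 → Fin 3 → (W →ₗ[ℂ] ℂ)) (a c : Fin 3 → (W →ₗ[ℂ] ℂ)),
    ∀ v, f v = det3 (fun i j => B i j v) + ∑ i, ∑ j, a i v * B i j v * c j v

/-- the skew matrix -/
def skw {R : Type*} [CommRing R] (B : Fin 3 → Fin 3 → R) (a c : Fin 3 → R) :
    Matrix (Fin 6) (Fin 6) R :=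
  !![0, a 2, -a 1, B 0 0, B 0 1, B 0 2;
     -a 2, 0, a 0, B 1 0, B 1 1, B 1 2;
     a 1, -a 0, 0, B 2 0, B 2 1, B 2 2;
     -B 0 0, -B 1 0, -B 2 0, 0, -c 2, c 1;
     -B 0 1, -B 1 1, -B 2 1, c 2, 0, -c 0;
     -B 0 2, -B 1 2, -B 2 2, -c 1, c 0, 0]

set_option maxHeartbeats 4000000 in
theorem det_skw (B : Fin 3 → Fin 3 → ℂ) (a c : Fin 3 → ℂ) :
    (skw B a c).det = (det3 B + ∑ i, ∑ j, a i * B i j * c j) ^ 2 := by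
  simp only [skw, det3, Fin.sum_univ_three]
  generalize B 0 0 = b1
  generalize B 0 1 = b2
  generalize B 0 2 = b3
  generalize B 1 0 = b4
  generalize B 1 1 = b5
  generalize B 1 2 = b6
  generalize B 2 0 = b7
  generalize B 2 1 = b8
  generalize B 2 2 = b9
  generalize a 0 = a0
  generalize a 1 = a1
  generalize a 2 = a2
  generalize c 0 = c0
  generalize c 1 = c1
  generalize c 2 = c2
  simp [Matrix.det_succ_row_zero, Fin.sum_univ_succ, Fin.succAbove]
  ring

theorem IsPf.final (F : MvPolynomial (Fin 5) ℂ)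
    (h : IsPf (fun v : Fin 5 → ℂ => MvPolynomial.eval v F)) :
    ∃ M : Matrix (Fin 6) (Fin 6) (MvPolynomial (Fin 5) ℂ),
      (∀ i j, (M i j).IsHomogeneous 1) ∧ M.transpose = -M ∧ M.det = F ^ 2 := by
  obtain ⟨B, a, c, h⟩ := h
  let lin : ((Fin 5 → ℂ) →ₗ[ℂ] ℂ) → MvPolynomial (Fin 5) ℂ := fun φ =>
    ∑ i, MvPolynomial.C (φ (Pi.single i 1)) * MvPolynomial.X i
  have hlin : ∀ φ, (lin φ).IsHomogeneous 1 := by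
    intro φ
    apply MvPolynomial.IsHomogeneous.sum
    intro i _
    have := (MvPolynomial.isHomogeneous_C (Fin 5) (φ (Pi.single i 1))).mul
      (MvPolynomial.isHomogeneous_X ℂ i)
    simpa using this
  have heval : ∀ φ v, MvPolynomial.eval v (lin φ) = φ v := by
    intro φ v
    conv_rhs => rw [LinearMap.pi_apply_eq_sum_univ φ v]
    simp only [lin, map_sum, map_mul, MvPolynomial.eval_C, MvPolynomial.eval_X, smul_eq_mul]
    refine Finset.sum_congr rfl fun i _ => ?_
    rw [mul_comm]
    congr 2
    ext j
    simp [Pi.single_apply, eq_comm]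
  refine ⟨skw (fun i j => lin (B i j)) (fun i => lin (a i)) (fun i => lin (c i)), ?_, ?_, ?_⟩
  · have h0 : (0 : MvPolynomial (Fin 5) ℂ).IsHomogeneous 1 := MvPolynomial.isHomogeneous_zero _ _ _
    intro i j
    fin_cases i <;> fin_cases j <;> simp [skw, hlin, h0, (hlin _).neg]
  · ext1 i j
    fin_cases i <;> fin_cases j <;> simp [skw]
  · apply MvPolynomial.funext
    intro v
    have e : MvPolynomial.eval v (skw (fun i j => lin (B i j)) (fun i => lin (a i))
        (fun i => lin (c i))).det = (skw (fun i j => B i j v) (fun i => a i v)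
        (fun i => c i v)).det := by
      rw [RingHom.map_det]
      congr 1
      ext1 i j
      fin_cases i <;> fin_cases j <;> simp [skw, heval]
    have hv := h v
    beta_reduce at hv
    rw [e, det_skw, map_pow, hv]

/-- f is a cubic form given by a symmetric trilinear form -/
def SymT {W : Type*} [AddCommGroup W] [Module ℂ W] (T : W →ₗ[ℂ] W →ₗ[ℂ] W →ₗ[ℂ] ℂ) : Prop :=
  (∀ u v w, T u v w = T v u w) ∧ (∀ u v w, T u v w = T u w v)

theorem exists_T (F : MvPolynomial (Fin 5) ℂ) (hF : F.IsHomogeneous 3) :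
    ∃ T : (Fin 5 → ℂ) →ₗ[ℂ] (Fin 5 → ℂ) →ₗ[ℂ] (Fin 5 → ℂ) →ₗ[ℂ] ℂ, SymT T ∧
      ∀ v, MvPolynomial.eval v F = T v v v := by
  let P : ((Fin 5 → ℂ) → ℂ) → Prop := fun f =>
    ∃ T : (Fin 5 → ℂ) →ₗ[ℂ] (Fin 5 → ℂ) →ₗ[ℂ] (Fin 5 → ℂ) →ₗ[ℂ] ℂ, SymT T ∧ ∀ v, f v = T v v v
  have hmon : ∀ d ∈ F.support, P (fun v => MvPolynomial.eval v (MvPolynomial.monomial d (F.coeff d))) := by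
    intro d hd
    have hdeg : (Finsupp.toMultiset d).card = 3 := by
      have := hF (MvPolynomial.mem_support_iff.mp hd)
      rw [Finsupp.card_toMultiset]
      simp [Finsupp.weight_apply] at this
      exact this
    obtain ⟨i, j, k, hijk⟩ := Multiset.card_eq_three.mp hdeg
    let pr : Fin 5 → ((Fin 5 → ℂ) →ₗ[ℂ] ℂ) := fun i => LinearMap.proj i
    let S : Fin 5 → Fin 5 → Fin 5 → ((Fin 5 → ℂ) →ₗ[ℂ] (Fin 5 → ℂ) →ₗ[ℂ] (Fin 5 → ℂ) →ₗ[ℂ] ℂ) :=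
      fun i j k => (pr i).smulRight ((pr j).smulRight (pr k))
    refine ⟨(F.coeff d / 6) • (S i j k + S i k j + S j i k + S j k i + S k i j + S k j i),
      ⟨fun u v w => ?_, fun u v w => ?_⟩, fun v => ?_⟩
    · simp [S, pr]; ring
    · simp [S, pr]; ring
    · have : d.prod (fun i n => v i ^ n) = v i * v j * v k := by
        have h1 := Finsupp.prod_toMultiset (d.mapDomain v)
        have h2 : (Finsupp.toMultiset (d.mapDomain v)) = (Finsupp.toMultiset d).map v :=
          (Finsupp.toMultiset_map d v).symm
        rw [h2, hijk, Finsupp.prod_mapDomain_index (by simp) (by intros; simp [pow_add])] at h1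
        rw [← h1]; simp [mul_assoc]
      simp [MvPolynomial.eval_monomial, this, S, pr]; ring
  have hsum : ∀ s ⊆ F.support, P (fun v => ∑ d ∈ s, MvPolynomial.eval v (MvPolynomial.monomial d (F.coeff d))) := by
    intro s
    induction s using Finset.induction_on with
    | empty => intro _; exact ⟨0, ⟨by simp, by simp⟩, by simp⟩
    | insert a s ha ih =>
      intro hs
      obtain ⟨T1, h1, h1'⟩ := hmon a (hs (Finset.mem_insert_self _ _))
      obtain ⟨T2, h2, h2'⟩ := ih (fun x hx => hs (Finset.mem_insert_of_mem hx))
      refine ⟨T1 + T2, ⟨fun u v w => ?_, fun u v w => ?_⟩, fun v => ?_⟩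
      · simp only [LinearMap.add_apply]; rw [h1.1, h2.1]
      · simp only [LinearMap.add_apply]; rw [h1.2, h2.2]
      · have e1 := h1' v
        have e2 := h2' v
        beta_reduce at e1 e2
        simp only [LinearMap.add_apply]; rw [Finset.sum_insert ha, e1, e2]
  obtain ⟨T, hT, h⟩ := hsum F.support (fun _ h => h)
  refine ⟨T, hT, fun v => ?_⟩
  have e := h v
  beta_reduce at e
  rw [← e, ← map_sum, ← F.as_sum]

end CubicPf


namespace CubicPf

variable {W : Type*} [AddCommGroup W] [Module ℂ W]

theorem cubic_add {T : W →ₗ[ℂ] W →ₗ[ℂ] W →ₗ[ℂ] ℂ} (hT : SymT T) (u v : W) :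
    T (u + v) (u + v) (u + v) = T u u u + 3 * T u u v + 3 * T u v v + T v v v := by
  simp only [map_add, LinearMap.add_apply]
  rw [hT.1 v u u, hT.2 u v u, hT.1 v u v, hT.2 v v u, hT.1 v u v]
  ring

theorem quad_add {T : W →ₗ[ℂ] W →ₗ[ℂ] W →ₗ[ℂ] ℂ} (hT : SymT T) (u v w : W) :
    T (u + v) (u + v) w = T u u w + 2 * T u v w + T v v w := by
  simp only [map_add, LinearMap.add_apply]
  rw [hT.1 v u w]
  ring

theorem engine [FiniteDimensional ℂ W] (hW : Module.finrank ℂ W = 5)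
    (T : W →ₗ[ℂ] W →ₗ[ℂ] W →ₗ[ℂ] ℂ) (hT : SymT T)
    (s : W →ₗ[ℂ] ℂ) (B : Fin 3 → Fin 3 → (W →ₗ[ℂ] ℂ))
    (hB : ∀ v, s v = 0 → T v v v = det3 (fun i j => B i j v))
    (a : Fin 3 → ℂ) (p w : W)
    (hker : ∀ v, s v = 0 → (∀ j, ∑ i, a i * B i j v = 0) → ∃ c : ℂ, v = c • p)
    (hw : s w = 1)
    (h1 : T p p w = 0) (h2 : T p w w = 0) (h3 : T w w w = 0)
    (hsp : s p = 0) (hbp : ∀ j, ∑ i, a i * B i j p = 0) :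
    IsPf (fun v => T v v v) := by
  let b : Fin 3 → (W →ₗ[ℂ] ℂ) := fun j => ∑ i, a i • B i j
  let b' : Fin 3 → (W →ₗ[ℂ] ℂ) := fun j => b j - (b j w) • s
  have hb : ∀ j v, b j v = ∑ i, a i * B i j v := by intro j v; simp [b]
  have hb' : ∀ j v, b' j v = b j v - b j w * s v := by intro j v; simp [b']
  have hb'p : ∀ j, b' j p = 0 := by intro j; rw [hb', hb, hbp, hsp]; ring
  have hb'w : ∀ j, b' j w = 0 := by intro j; rw [hb', hw]; ring
  let Φ : W →ₗ[ℂ] (Fin 3 → ℂ) × ℂ := (LinearMap.pi b').prod s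
  have hΦ : Function.Surjective Φ := by
    have hk : LinearMap.ker Φ ≤ Submodule.span ℂ {p} := by
      intro v hv
      have hv' : (∀ j, b' j v = 0) ∧ s v = 0 := by
        rw [LinearMap.mem_ker] at hv
        have e1 := congrArg Prod.fst hv
        have e2 := congrArg Prod.snd hv
        exact ⟨fun j => congrFun e1 j, e2⟩
      obtain ⟨c, hc⟩ := hker v hv'.2 (fun j => by
        have := hv'.1 j
        rw [hb', hv'.2, hb] at this
        simpa using this)
      rw [Submodule.mem_span_singleton]
      exact ⟨c, hc.symm⟩
    have h1 := Submodule.finrank_mono hk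
    have h2 : Module.finrank ℂ (Submodule.span ℂ ({p} : Set W)) ≤ 1 := by
      have := finrank_span_le_card (R := ℂ) ({p} : Set W)
      simpa using this
    have h3 := LinearMap.finrank_range_add_finrank_ker Φ
    rw [← LinearMap.range_eq_top]
    apply Submodule.eq_top_of_finrank_eq
    apply le_antisymm (Submodule.finrank_le _)
    have : Module.finrank ℂ ((Fin 3 → ℂ) × ℂ) = 4 := by simp
    omega
  have hex : ∀ j : Fin 3, ∃ e : W, (∀ i, b' i e = if i = j then 1 else 0) ∧ s e = 0 := by
    intro j
    obtain ⟨e, he⟩ := hΦ (fun i => if i = j then 1 else 0, 0)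
    exact ⟨e, fun i => congrFun (congrArg Prod.fst he) i, congrArg Prod.snd he⟩
  choose e he hse using hex
  let Y : W →ₗ[ℂ] W := ∑ j, (b' j).smulRight (e j)
  have hY : ∀ v, Y v = b' 0 v • e 0 + b' 1 v • e 1 + b' 2 v • e 2 := by
    intro v; simp [Y, Fin.sum_univ_three]
  have hr : ∀ v, ∃ c : ℂ, v = Y v + c • p + s v • w := by
    intro v
    obtain ⟨c, hc⟩ := hker (v - Y v - s v • w) (by simp [hY, hse, hw]) (by
      intro j
      rw [← hb]
      have : b j (v - Y v - s v • w) = b' j (v - Y v - s v • w) := by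
        rw [hb' j, map_sub s, map_sub s, map_smul, hw, hY]; simp [hse]
      rw [this, map_sub, map_sub, map_smul, hb'w, hY]
      simp only [map_add, map_smul, he]
      fin_cases j <;> simp)
    refine ⟨c, ?_⟩
    rw [← hc]; abel
  let c : Fin 3 → (W →ₗ[ℂ] ℂ) := fun j =>
    (3:ℂ) • (((T (e j)).flip w).comp ((2:ℂ) • (LinearMap.id - s.smulRight w) - Y)) +
      (3 * T (e j) w w) • s
  have hc : ∀ j v, c j v = 3 * (T (e j) ((2:ℂ) • (v - s v • w) - Y v) w) + 3 * T (e j) w w * s v := by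
    intro j v; simp [c]
  refine ⟨fun i j => B i j - (B i j w) • s, fun i => a i • s, c, ?_⟩
  intro v
  obtain ⟨r, hr⟩ := hr v
  set y := Y v with hy
  set σ := s v with hσ
  have hu : s (y + r • p) = 0 := by
    rw [hy, hY]; simp [hse, hsp]
  have hf := hB _ hu
  have hBu : ∀ i j, (B i j - (B i j w) • s) v = B i j (y + r • p) := by
    intro i j
    have : y + r • p = v - σ • w := by rw [hr]; abel
    rw [this]; simp [hσ, mul_comm]
  have hab : ∀ j, ∑ i, a i * B i j (y + r • p) = b' j v := by
    intro j
    rw [← hb]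
    have : y + r • p = v - σ • w := by rw [hr]; abel
    rw [this, hb']; simp [hσ, mul_comm]
  simp only [hBu]
  rw [← hf]
  have key : ∑ i, ∑ j, (a i • s) v * B i j (y + r • p) * c j v = σ * ∑ j, b' j v * c j v := by
    simp only [← hab, Fin.sum_univ_three, LinearMap.smul_apply, smul_eq_mul]
    rw [← hσ]; ring
  rw [key]
  have hv2 : (2:ℂ) • (v - σ • w) - y = y + (2 * r) • p := by
    have : v - σ • w = y + r • p := by rw [hr]; abel
    rw [this]; module
  have hcv : ∀ j, c j v = 3 * (T (e j) (y + (2 * r) • p) w) + 3 * T (e j) w w * σ := by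
    intro j; rw [hc, ← hσ, ← hy, hv2]
  have hyT : ∀ u u', T y u u' = ∑ j, b' j v * T (e j) u u' := by
    intro u u'
    rw [hy, hY]; simp [Fin.sum_univ_three]
  have hs : ∑ j, b' j v * c j v = 3 * T y (y + (2 * r) • p) w + 3 * T y w w * σ := by
    rw [hyT, hyT]; simp only [hcv, Fin.sum_univ_three]; ring
  have q1 := cubic_add hT (y + r • p) (σ • w)
  have q2 := quad_add hT y (r • p) (σ • w)
  rw [hs, hr, q1, q2]
  simp only [map_add, map_smul, LinearMap.add_apply, LinearMap.smul_apply, smul_eq_mul, h1, h2, h3]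
  ring

theorem crit2 (f : W → ℂ) (x y : W →ₗ[ℂ] ℂ) (α β γ : Fin 3 → (W →ₗ[ℂ] ℂ))
    (h : ∀ v, f v = x v * (α 0 v * γ 0 v + α 1 v * γ 1 v + α 2 v * γ 2 v)
      + y v * (β 0 v * γ 0 v + β 1 v * γ 1 v + β 2 v * γ 2 v)) : IsPf f := by
  refine ⟨![fun _ => 0, α, β], ![0, x, y], γ, fun v => ?_⟩
  rw [h]
  simp [Fin.sum_univ_three, det3]
  ring

end CubicPf


set_option linter.unusedSimpArgs false

namespace CubicPf

variable {W : Type*} [AddCommGroup W] [Module ℂ W]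

theorem qexp2 {T : W →ₗ[ℂ] W →ₗ[ℂ] W →ₗ[ℂ] ℂ} (hT : SymT T) (u0 u1 w : W) (x0 x1 : ℂ) :
    T (x0 • u0 + x1 • u1) (x0 • u0 + x1 • u1) w =
      x0 * x0 * T u0 u0 w + 2 * x0 * x1 * T u0 u1 w + x1 * x1 * T u1 u1 w := by
  rw [quad_add hT (x0 • u0) (x1 • u1)]
  simp only [map_add, map_smul, LinearMap.add_apply, LinearMap.smul_apply, smul_eq_mul]
  ring

theorem exp2 {T : W →ₗ[ℂ] W →ₗ[ℂ] W →ₗ[ℂ] ℂ} (hT : SymT T) (u0 u1 : W) (x0 x1 : ℂ) :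
    T (x0 • u0 + x1 • u1) (x0 • u0 + x1 • u1) (x0 • u0 + x1 • u1) =
      x0 * x0 * x0 * T u0 u0 u0 + 3 * x0 * x0 * x1 * T u0 u0 u1 + 3 * x0 * x1 * x1 * T u0 u1 u1 + x1
      * x1 * x1 * T u1 u1 u1 := by
  rw [cubic_add hT (x0 • u0) (x1 • u1)]
  simp only [map_add, map_smul, LinearMap.add_apply, LinearMap.smul_apply, smul_eq_mul]
  ring

theorem qexp3 {T : W →ₗ[ℂ] W →ₗ[ℂ] W →ₗ[ℂ] ℂ} (hT : SymT T) (u0 u1 u2 w : W) (x0 x1 x2 : ℂ) :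
    T (x0 • u0 + x1 • u1 + x2 • u2) (x0 • u0 + x1 • u1 + x2 • u2) w =
      x0 * x0 * T u0 u0 w + 2 * x0 * x1 * T u0 u1 w + 2 * x0 * x2 * T u0 u2 w + x1 * x1 * T u1 u1 w +
      2 * x1 * x2 * T u1 u2 w + x2 * x2 * T u2 u2 w := by
  rw [quad_add hT (x0 • u0 + x1 • u1) (x2 • u2), qexp2 hT u0 u1 w x0 x1]
  simp only [map_add, map_smul, LinearMap.add_apply, LinearMap.smul_apply, smul_eq_mul]
  ring

theorem exp3 {T : W →ₗ[ℂ] W →ₗ[ℂ] W →ₗ[ℂ] ℂ} (hT : SymT T) (u0 u1 u2 : W) (x0 x1 x2 : ℂ) :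
    T (x0 • u0 + x1 • u1 + x2 • u2) (x0 • u0 + x1 • u1 + x2 • u2) (x0 • u0 + x1 • u1 + x2 • u2) =
      x0 * x0 * x0 * T u0 u0 u0 + 3 * x0 * x0 * x1 * T u0 u0 u1 + 3 * x0 * x0 * x2 * T u0 u0 u2 + 3 *
      x0 * x1 * x1 * T u0 u1 u1 + 6 * x0 * x1 * x2 * T u0 u1 u2 + 3 * x0 * x2 * x2 * T u0 u2 u2 + x1
      * x1 * x1 * T u1 u1 u1 + 3 * x1 * x1 * x2 * T u1 u1 u2 + 3 * x1 * x2 * x2 * T u1 u2 u2 + x2 *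
      x2 * x2 * T u2 u2 u2 := by
  rw [cubic_add hT (x0 • u0 + x1 • u1) (x2 • u2), exp2 hT u0 u1 x0 x1, qexp2 hT u0 u1 _ x0 x1]
  simp only [map_add, map_smul, LinearMap.add_apply, LinearMap.smul_apply, smul_eq_mul]
  ring

theorem qexp4 {T : W →ₗ[ℂ] W →ₗ[ℂ] W →ₗ[ℂ] ℂ} (hT : SymT T) (u0 u1 u2 u3 w : W) (x0 x1 x2 x3 : ℂ) :
    T (x0 • u0 + x1 • u1 + x2 • u2 + x3 • u3) (x0 • u0 + x1 • u1 + x2 • u2 + x3 • u3) w =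
      x0 * x0 * T u0 u0 w + 2 * x0 * x1 * T u0 u1 w + 2 * x0 * x2 * T u0 u2 w + 2 * x0 * x3 * T u0 u3
      w + x1 * x1 * T u1 u1 w + 2 * x1 * x2 * T u1 u2 w + 2 * x1 * x3 * T u1 u3 w + x2 * x2 * T u2 u2
      w + 2 * x2 * x3 * T u2 u3 w + x3 * x3 * T u3 u3 w := by
  rw [quad_add hT (x0 • u0 + x1 • u1 + x2 • u2) (x3 • u3), qexp3 hT u0 u1 u2 w x0 x1 x2]
  simp only [map_add, map_smul, LinearMap.add_apply, LinearMap.smul_apply, smul_eq_mul]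
  ring

theorem exp4 {T : W →ₗ[ℂ] W →ₗ[ℂ] W →ₗ[ℂ] ℂ} (hT : SymT T) (u0 u1 u2 u3 : W) (x0 x1 x2 x3 : ℂ) :
    T (x0 • u0 + x1 • u1 + x2 • u2 + x3 • u3) (x0 • u0 + x1 • u1 + x2 • u2 + x3 • u3) (x0 • u0 + x1 • u1 + x2 • u2 + x3 • u3) =
      x0 * x0 * x0 * T u0 u0 u0 + 3 * x0 * x0 * x1 * T u0 u0 u1 + 3 * x0 * x0 * x2 * T u0 u0 u2 + 3 *
      x0 * x0 * x3 * T u0 u0 u3 + 3 * x0 * x1 * x1 * T u0 u1 u1 + 6 * x0 * x1 * x2 * T u0 u1 u2 + 6 *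
      x0 * x1 * x3 * T u0 u1 u3 + 3 * x0 * x2 * x2 * T u0 u2 u2 + 6 * x0 * x2 * x3 * T u0 u2 u3 + 3 *
      x0 * x3 * x3 * T u0 u3 u3 + x1 * x1 * x1 * T u1 u1 u1 + 3 * x1 * x1 * x2 * T u1 u1 u2 + 3 * x1
      * x1 * x3 * T u1 u1 u3 + 3 * x1 * x2 * x2 * T u1 u2 u2 + 6 * x1 * x2 * x3 * T u1 u2 u3 + 3 * x1
      * x3 * x3 * T u1 u3 u3 + x2 * x2 * x2 * T u2 u2 u2 + 3 * x2 * x2 * x3 * T u2 u2 u3 + 3 * x2 *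
      x3 * x3 * T u2 u3 u3 + x3 * x3 * x3 * T u3 u3 u3 := by
  rw [cubic_add hT (x0 • u0 + x1 • u1 + x2 • u2) (x3 • u3), exp3 hT u0 u1 u2 x0 x1 x2, qexp3 hT u0 u1 u2 _ x0 x1 x2]
  simp only [map_add, map_smul, LinearMap.add_apply, LinearMap.smul_apply, smul_eq_mul]
  ring

theorem qexp5 {T : W →ₗ[ℂ] W →ₗ[ℂ] W →ₗ[ℂ] ℂ} (hT : SymT T) (u0 u1 u2 u3 u4 w : W) (x0 x1 x2 x3 x4 : ℂ) :
    T (x0 • u0 + x1 • u1 + x2 • u2 + x3 • u3 + x4 • u4) (x0 • u0 + x1 • u1 + x2 • u2 + x3 • u3 + x4 • u4) w =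
      x0 * x0 * T u0 u0 w + 2 * x0 * x1 * T u0 u1 w + 2 * x0 * x2 * T u0 u2 w + 2 * x0 * x3 * T u0 u3
      w + 2 * x0 * x4 * T u0 u4 w + x1 * x1 * T u1 u1 w + 2 * x1 * x2 * T u1 u2 w + 2 * x1 * x3 * T
      u1 u3 w + 2 * x1 * x4 * T u1 u4 w + x2 * x2 * T u2 u2 w + 2 * x2 * x3 * T u2 u3 w + 2 * x2 * x4
      * T u2 u4 w + x3 * x3 * T u3 u3 w + 2 * x3 * x4 * T u3 u4 w + x4 * x4 * T u4 u4 w := by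
  rw [quad_add hT (x0 • u0 + x1 • u1 + x2 • u2 + x3 • u3) (x4 • u4), qexp4 hT u0 u1 u2 u3 w x0 x1 x2 x3]
  simp only [map_add, map_smul, LinearMap.add_apply, LinearMap.smul_apply, smul_eq_mul]
  ring

theorem exp5 {T : W →ₗ[ℂ] W →ₗ[ℂ] W →ₗ[ℂ] ℂ} (hT : SymT T) (u0 u1 u2 u3 u4 : W) (x0 x1 x2 x3 x4 : ℂ) :
    T (x0 • u0 + x1 • u1 + x2 • u2 + x3 • u3 + x4 • u4) (x0 • u0 + x1 • u1 + x2 • u2 + x3 • u3 + x4 • u4) (x0 • u0 + x1 • u1 + x2 • u2 + x3 • u3 + x4 • u4) =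
      x0 * x0 * x0 * T u0 u0 u0 + 3 * x0 * x0 * x1 * T u0 u0 u1 + 3 * x0 * x0 * x2 * T u0 u0 u2 + 3 *
      x0 * x0 * x3 * T u0 u0 u3 + 3 * x0 * x0 * x4 * T u0 u0 u4 + 3 * x0 * x1 * x1 * T u0 u1 u1 + 6 *
      x0 * x1 * x2 * T u0 u1 u2 + 6 * x0 * x1 * x3 * T u0 u1 u3 + 6 * x0 * x1 * x4 * T u0 u1 u4 + 3 *
      x0 * x2 * x2 * T u0 u2 u2 + 6 * x0 * x2 * x3 * T u0 u2 u3 + 6 * x0 * x2 * x4 * T u0 u2 u4 + 3 *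
      x0 * x3 * x3 * T u0 u3 u3 + 6 * x0 * x3 * x4 * T u0 u3 u4 + 3 * x0 * x4 * x4 * T u0 u4 u4 + x1
      * x1 * x1 * T u1 u1 u1 + 3 * x1 * x1 * x2 * T u1 u1 u2 + 3 * x1 * x1 * x3 * T u1 u1 u3 + 3 * x1
      * x1 * x4 * T u1 u1 u4 + 3 * x1 * x2 * x2 * T u1 u2 u2 + 6 * x1 * x2 * x3 * T u1 u2 u3 + 6 * x1
      * x2 * x4 * T u1 u2 u4 + 3 * x1 * x3 * x3 * T u1 u3 u3 + 6 * x1 * x3 * x4 * T u1 u3 u4 + 3 * x1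
      * x4 * x4 * T u1 u4 u4 + x2 * x2 * x2 * T u2 u2 u2 + 3 * x2 * x2 * x3 * T u2 u2 u3 + 3 * x2 *
      x2 * x4 * T u2 u2 u4 + 3 * x2 * x3 * x3 * T u2 u3 u3 + 6 * x2 * x3 * x4 * T u2 u3 u4 + 3 * x2 *
      x4 * x4 * T u2 u4 u4 + x3 * x3 * x3 * T u3 u3 u3 + 3 * x3 * x3 * x4 * T u3 u3 u4 + 3 * x3 * x4
      * x4 * T u3 u4 u4 + x4 * x4 * x4 * T u4 u4 u4 := by
  rw [cubic_add hT (x0 • u0 + x1 • u1 + x2 • u2 + x3 • u3) (x4 • u4), exp4 hT u0 u1 u2 u3 x0 x1 x2 x3, qexp4 hT u0 u1 u2 u3 _ x0 x1 x2 x3]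
  simp only [map_add, map_smul, LinearMap.add_apply, LinearMap.smul_apply, smul_eq_mul]
  ring

theorem chg [FiniteDimensional ℂ W] (hW : Module.finrank ℂ W = 5) (e : Fin 5 → W)
    (h : ∀ v, ∃ x0 x1 x2 x3 x4 : ℂ,
      v = x0 • e 0 + x1 • e 1 + x2 • e 2 + x3 • e 3 + x4 • e 4) :
    ∃ b : Module.Basis (Fin 5) ℂ W, ∀ i, b i = e i := by
  refine ⟨basisOfTopLeSpanOfCardEqFinrank e ?_ (by simp [hW]), fun i => by rw [coe_basisOfTopLeSpanOfCardEqFinrank]⟩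
  intro v _
  obtain ⟨x0, x1, x2, x3, x4, hv⟩ := h v
  have hm : ∀ i, e i ∈ Submodule.span ℂ (Set.range e) := fun i => Submodule.subset_span ⟨i, rfl⟩
  rw [hv]
  exact Submodule.add_mem _ (Submodule.add_mem _ (Submodule.add_mem _ (Submodule.add_mem _
    (Submodule.smul_mem _ _ (hm 0)) (Submodule.smul_mem _ _ (hm 1)))
    (Submodule.smul_mem _ _ (hm 2))) (Submodule.smul_mem _ _ (hm 3)))
    (Submodule.smul_mem _ _ (hm 4))

/-- quintuple spanning -/
def Sp (e0 e1 e2 e3 e4 : W) : Prop := ∀ v, ∃ x0 x1 x2 x3 x4 : ℂ,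
      v = x0 • e0 + x1 • e1 + x2 • e2 + x3 • e3 + x4 • e4

theorem Sp.of {e0 e1 e2 e3 e4 : W} (h : Sp e0 e1 e2 e3 e4) (e : Fin 5 → W)
    (h0 : e0 ∈ Submodule.span ℂ (Set.range e)) (h1 : e1 ∈ Submodule.span ℂ (Set.range e))
    (h2 : e2 ∈ Submodule.span ℂ (Set.range e)) (h3 : e3 ∈ Submodule.span ℂ (Set.range e))
    (h4 : e4 ∈ Submodule.span ℂ (Set.range e)) : Sp (e 0) (e 1) (e 2) (e 3) (e 4) := by
  intro v
  obtain ⟨x0, x1, x2, x3, x4, hv⟩ := h v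
  have : v ∈ Submodule.span ℂ (Set.range e) := by
    rw [hv]
    exact Submodule.add_mem _ (Submodule.add_mem _ (Submodule.add_mem _ (Submodule.add_mem _
      (Submodule.smul_mem _ _ h0) (Submodule.smul_mem _ _ h1))
      (Submodule.smul_mem _ _ h2)) (Submodule.smul_mem _ _ h3))
      (Submodule.smul_mem _ _ h4)
  rw [Submodule.mem_span_range_iff_exists_fun] at this
  obtain ⟨c, hc⟩ := this
  refine ⟨c 0, c 1, c 2, c 3, c 4, ?_⟩
  rw [← hc, Fin.sum_univ_five]

theorem Sp.chg {e0 e1 e2 e3 e4 : W} (h : Sp e0 e1 e2 e3 e4) (f0 f1 f2 f3 f4 : W)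
    (h0 : ∃ x0 x1 x2 x3 x4 : ℂ, e0 = x0 • f0 + x1 • f1 + x2 • f2 + x3 • f3 + x4 • f4)
    (h1 : ∃ x0 x1 x2 x3 x4 : ℂ, e1 = x0 • f0 + x1 • f1 + x2 • f2 + x3 • f3 + x4 • f4)
    (h2 : ∃ x0 x1 x2 x3 x4 : ℂ, e2 = x0 • f0 + x1 • f1 + x2 • f2 + x3 • f3 + x4 • f4)
    (h3 : ∃ x0 x1 x2 x3 x4 : ℂ, e3 = x0 • f0 + x1 • f1 + x2 • f2 + x3 • f3 + x4 • f4)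
    (h4 : ∃ x0 x1 x2 x3 x4 : ℂ, e4 = x0 • f0 + x1 • f1 + x2 • f2 + x3 • f3 + x4 • f4) :
    Sp f0 f1 f2 f3 f4 := by
  have key : ∀ e : W, (∃ x0 x1 x2 x3 x4 : ℂ, e = x0 • f0 + x1 • f1 + x2 • f2 + x3 • f3 + x4 • f4) →
      e ∈ Submodule.span ℂ (Set.range ![f0, f1, f2, f3, f4]) := by
    rintro e ⟨x0, x1, x2, x3, x4, he⟩
    rw [Submodule.mem_span_range_iff_exists_fun]
    refine ⟨![x0, x1, x2, x3, x4], ?_⟩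
    rw [he, Fin.sum_univ_five]; rfl
  exact h.of ![f0, f1, f2, f3, f4] (key _ h0) (key _ h1) (key _ h2) (key _ h3) (key _ h4)

theorem Sp.basis [FiniteDimensional ℂ W] (hW : Module.finrank ℂ W = 5) {e0 e1 e2 e3 e4 : W}
    (h : Sp e0 e1 e2 e3 e4) : ∃ b : Module.Basis (Fin 5) ℂ W,
      b 0 = e0 ∧ b 1 = e1 ∧ b 2 = e2 ∧ b 3 = e3 ∧ b 4 = e4 := by
  obtain ⟨b, hb⟩ := CubicPf.chg hW ![e0, e1, e2, e3, e4] (by simpa [Sp] using h)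
  exact ⟨b, hb 0, hb 1, hb 2, hb 3, hb 4⟩

theorem Sp.coord [FiniteDimensional ℂ W] (hW : Module.finrank ℂ W = 5) {e0 e1 e2 e3 e4 : W}
    (h : Sp e0 e1 e2 e3 e4) : ∃ x : Fin 5 → (W →ₗ[ℂ] ℂ),
      (∀ v, v = x 0 v • e0 + x 1 v • e1 + x 2 v • e2 + x 3 v • e3 + x 4 v • e4) ∧
      (∀ i y0 y1 y2 y3 y4, x i (y0 • e0 + y1 • e1 + y2 • e2 + y3 • e3 + y4 • e4)
        = ![y0, y1, y2, y3, y4] i) := by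
  obtain ⟨b, h0, h1, h2, h3, h4⟩ := h.basis hW
  refine ⟨b.coord, fun v => ?_, fun i y0 y1 y2 y3 y4 => ?_⟩
  · have := b.sum_repr v
    rw [Fin.sum_univ_five, h0, h1, h2, h3, h4] at this
    exact this.symm
  · rw [← h0, ← h1, ← h2, ← h3, ← h4]
    fin_cases i <;> simp

/-! binary forms -/
open Polynomial in
theorem binroot (n : ℕ) (hn : 1 ≤ n) (c : ℕ → ℂ) : ∃ a b : ℂ, (a ≠ 0 ∨ b ≠ 0) ∧
    ∑ i ∈ Finset.range (n + 1), c i * a ^ i * b ^ (n - i) = 0 := by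
  by_cases h : c n = 0
  · refine ⟨1, 0, Or.inl one_ne_zero, ?_⟩
    rw [Finset.sum_range_succ, h]
    simp only [zero_mul, add_zero]
    apply Finset.sum_eq_zero
    intro i hi
    have : n - i ≠ 0 := by have := Finset.mem_range.mp hi; omega
    simp [this]
  · let P : ℂ[X] := ∑ i ∈ Finset.range (n + 1), C (c i) * X ^ i
    have hc : P.coeff n = c n := by simp [P, Polynomial.coeff_X_pow]
    have hd : P.degree ≠ 0 := by
      intro h0
      have : P.coeff n = 0 := by
        apply Polynomial.coeff_eq_zero_of_degree_lt
        rw [h0]; exact_mod_cast hn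
      exact h (hc ▸ this)
    obtain ⟨a, ha⟩ := IsAlgClosed.exists_root P hd
    refine ⟨a, 1, Or.inr one_ne_zero, ?_⟩
    rw [Polynomial.IsRoot] at ha
    simpa [P, Polynomial.eval_finsetSum] using ha

theorem binroot2 (c0 c1 c2 : ℂ) : ∃ a b : ℂ, (a ≠ 0 ∨ b ≠ 0) ∧
    c0 * b ^ 2 + c1 * a * b + c2 * a ^ 2 = 0 := by
  obtain ⟨a, b, h, e⟩ := binroot 2 (by norm_num) (fun i => [c0, c1, c2].getD i 0)
  refine ⟨a, b, h, ?_⟩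
  simp [Finset.sum_range_succ] at e
  linear_combination e

theorem binroot3 (c0 c1 c2 c3 : ℂ) : ∃ a b : ℂ, (a ≠ 0 ∨ b ≠ 0) ∧
    c0 * b ^ 3 + c1 * a * b ^ 2 + c2 * a ^ 2 * b + c3 * a ^ 3 = 0 := by
  obtain ⟨a, b, h, e⟩ := binroot 3 (by norm_num) (fun i => [c0, c1, c2, c3].getD i 0)
  refine ⟨a, b, h, ?_⟩
  simp [Finset.sum_range_succ] at e
  linear_combination e

theorem binroot4 (c0 c1 c2 c3 c4 : ℂ) : ∃ a b : ℂ, (a ≠ 0 ∨ b ≠ 0) ∧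
    c0 * b ^ 4 + c1 * a * b ^ 3 + c2 * a ^ 2 * b ^ 2 + c3 * a ^ 3 * b + c4 * a ^ 4 = 0 := by
  obtain ⟨a, b, h, e⟩ := binroot 4 (by norm_num) (fun i => [c0, c1, c2, c3, c4].getD i 0)
  refine ⟨a, b, h, ?_⟩
  simp [Finset.sum_range_succ] at e
  linear_combination e

theorem binroot6 (c0 c1 c2 c3 c4 c5 c6 : ℂ) : ∃ a b : ℂ, (a ≠ 0 ∨ b ≠ 0) ∧
    c0 * b ^ 6 + c1 * a * b ^ 5 + c2 * a ^ 2 * b ^ 4 + c3 * a ^ 3 * b ^ 3 + c4 * a ^ 4 * b ^ 2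
      + c5 * a ^ 5 * b + c6 * a ^ 6 = 0 := by
  obtain ⟨a, b, h, e⟩ := binroot 6 (by norm_num) (fun i => [c0, c1, c2, c3, c4, c5, c6].getD i 0)
  refine ⟨a, b, h, ?_⟩
  simp [Finset.sum_range_succ] at e
  linear_combination e

open Polynomial in
theorem peel (n : ℕ) (P : ℂ[X]) (h : P.natDegree ≤ n + 1) :
    ∃ A P' : ℂ[X], A ≠ 0 ∧ A.natDegree ≤ 1 ∧ P'.natDegree ≤ n ∧ P = A * P' := by
  by_cases hn : P.natDegree ≤ n
  · exact ⟨1, P, one_ne_zero, by simp, hn, by simp⟩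
  · have hd : P.degree ≠ 0 := by
      intro h0
      have := Polynomial.natDegree_eq_zero_iff_degree_le_zero.mpr h0.le
      omega
    obtain ⟨a, ha⟩ := IsAlgClosed.exists_root P hd
    obtain ⟨P', hP'⟩ := Polynomial.dvd_iff_isRoot.mpr ha
    refine ⟨X - C a, P', Polynomial.X_sub_C_ne_zero a, by simp, ?_, hP'⟩
    have hP0 : P' ≠ 0 := by
      rintro rfl
      apply hn; simp [hP']
    have : P.natDegree = 1 + P'.natDegree := by
      rw [hP', Polynomial.natDegree_mul (Polynomial.X_sub_C_ne_zero a) hP0,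
        Polynomial.natDegree_X_sub_C]
    omega

open Polynomial in
theorem fac6 (p0 p1 p2 p3 p4 p5 p6 : ℂ) : ∃ c0 c1 c2 c3 d0 d1 d2 d3 : ℂ,
    ¬ (c0 = 0 ∧ c1 = 0 ∧ c2 = 0 ∧ c3 = 0) ∧ p0 = c0 * d0 ∧ p1 = c0 * d1 + c1 * d0 ∧
    p2 = c0 * d2 + c1 * d1 + c2 * d0 ∧ p3 = c0 * d3 + c1 * d2 + c2 * d1 + c3 * d0 ∧
    p4 = c1 * d3 + c2 * d2 + c3 * d1 ∧ p5 = c2 * d3 + c3 * d2 ∧ p6 = c3 * d3 := by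
  let P : ℂ[X] := C p0 + C p1 * X + C p2 * X ^ 2 + C p3 * X ^ 3 + C p4 * X ^ 4 + C p5 * X ^ 5
    + C p6 * X ^ 6
  have hP : P.natDegree ≤ 5 + 1 := by simp only [P]; compute_degree
  obtain ⟨A1, P1, hA1, hd1, hP1, e1⟩ := peel 5 P hP
  obtain ⟨A2, P2, hA2, hd2, hP2, e2⟩ := peel 4 P1 hP1
  obtain ⟨A3, P3, hA3, hd3, hP3, e3⟩ := peel 3 P2 hP2
  set A := A1 * A2 * A3 with hA
  have hA0 : A ≠ 0 := mul_ne_zero (mul_ne_zero hA1 hA2) hA3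
  have hAd : A.natDegree ≤ 3 := by
    refine Polynomial.natDegree_mul_le.trans ?_
    have := Polynomial.natDegree_mul_le (p := A1) (q := A2)
    omega
  have e : P = A * P3 := by rw [e1, e2, e3, hA]; ring
  have hz : ∀ n, 3 < n → A.coeff n = 0 := fun n hn =>
    Polynomial.coeff_eq_zero_of_natDegree_lt (by omega)
  have hz' : ∀ n, 3 < n → P3.coeff n = 0 := fun n hn =>
    Polynomial.coeff_eq_zero_of_natDegree_lt (by omega)
  have hc : ∀ n, P.coeff n = (A * P3).coeff n := fun n => by rw [e]
  refine ⟨A.coeff 0, A.coeff 1, A.coeff 2, A.coeff 3, P3.coeff 0, P3.coeff 1, P3.coeff 2,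
    P3.coeff 3, ?_, ?_, ?_, ?_, ?_, ?_, ?_, ?_⟩
  · rintro ⟨h0, h1, h2, h3⟩
    apply hA0
    ext n
    rcases n with _ | _ | _ | _ | n
    · simpa using h0
    · simpa using h1
    · simpa using h2
    · simpa using h3
    · rw [hz _ (by omega)]; simp
  · have := hc 0
    simp [P, Polynomial.coeff_mul, Finset.Nat.antidiagonal_succ, Polynomial.coeff_X_pow, Polynomial.coeff_X, Polynomial.coeff_C] at this
    linear_combination this
  · have := hc 1
    simp [P, Polynomial.coeff_mul, Finset.Nat.antidiagonal_succ, Polynomial.coeff_X_pow, Polynomial.coeff_X, Polynomial.coeff_C] at this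
    linear_combination this
  · have := hc 2
    simp [P, Polynomial.coeff_mul, Finset.Nat.antidiagonal_succ, Polynomial.coeff_X_pow, Polynomial.coeff_X, Polynomial.coeff_C] at this
    linear_combination this
  · have := hc 3
    simp [P, Polynomial.coeff_mul, Finset.Nat.antidiagonal_succ, Polynomial.coeff_X_pow, Polynomial.coeff_X, Polynomial.coeff_C] at this
    linear_combination this
  · have := hc 4
    simp [P, Polynomial.coeff_mul, Finset.Nat.antidiagonal_succ, Polynomial.coeff_X_pow, Polynomial.coeff_X, Polynomial.coeff_C, hz, hz'] at this
    linear_combination this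
  · have := hc 5
    simp [P, Polynomial.coeff_mul, Finset.Nat.antidiagonal_succ, Polynomial.coeff_X_pow, Polynomial.coeff_X, Polynomial.coeff_C, hz, hz'] at this
    linear_combination this
  · have := hc 6
    simp [P, Polynomial.coeff_mul, Finset.Nat.antidiagonal_succ, Polynomial.coeff_X_pow, Polynomial.coeff_X, Polynomial.coeff_C, hz, hz'] at this
    linear_combination this

open Polynomial in
theorem fac3 (p0 p1 p2 p3 : ℂ) : ∃ c0 c1 d0 d1 d2 : ℂ,
    ¬ (c0 = 0 ∧ c1 = 0) ∧ p0 = c0 * d0 ∧ p1 = c0 * d1 + c1 * d0 ∧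
    p2 = c0 * d2 + c1 * d1 ∧ p3 = c1 * d2 := by
  let P : ℂ[X] := C p0 + C p1 * X + C p2 * X ^ 2 + C p3 * X ^ 3
  have hP : P.natDegree ≤ 2 + 1 := by simp only [P]; compute_degree
  obtain ⟨A, P3, hA0, hAd, hP3, e⟩ := peel 2 P hP
  have hz : ∀ n, 1 < n → A.coeff n = 0 := fun n hn =>
    Polynomial.coeff_eq_zero_of_natDegree_lt (by omega)
  have hz' : ∀ n, 2 < n → P3.coeff n = 0 := fun n hn =>
    Polynomial.coeff_eq_zero_of_natDegree_lt (by omega)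
  have hc : ∀ n, P.coeff n = (A * P3).coeff n := fun n => by rw [e]
  refine ⟨A.coeff 0, A.coeff 1, P3.coeff 0, P3.coeff 1, P3.coeff 2, ?_, ?_, ?_, ?_, ?_⟩
  · rintro ⟨h0, h1⟩
    apply hA0
    ext n
    rcases n with _ | _ | n
    · simpa using h0
    · simpa using h1
    · rw [hz _ (by omega)]; simp
  · have := hc 0
    simp [P, Polynomial.coeff_mul, Finset.Nat.antidiagonal_succ, Polynomial.coeff_X_pow, Polynomial.coeff_X, Polynomial.coeff_C, hz, hz'] at this
    linear_combination this
  · have := hc 1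
    simp [P, Polynomial.coeff_mul, Finset.Nat.antidiagonal_succ, Polynomial.coeff_X_pow, Polynomial.coeff_X, Polynomial.coeff_C, hz, hz'] at this
    linear_combination this
  · have := hc 2
    simp [P, Polynomial.coeff_mul, Finset.Nat.antidiagonal_succ, Polynomial.coeff_X_pow, Polynomial.coeff_X, Polynomial.coeff_C, hz, hz'] at this
    linear_combination this
  · have := hc 3
    simp [P, Polynomial.coeff_mul, Finset.Nat.antidiagonal_succ, Polynomial.coeff_X_pow, Polynomial.coeff_X, Polynomial.coeff_C, hz, hz'] at this
    linear_combination this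

theorem fac2 (p0 p1 p2 : ℂ) : ∃ c0 c1 d0 d1 : ℂ,
    p0 = c0 * d0 ∧ p1 = c0 * d1 + c1 * d0 ∧ p2 = c1 * d1 := by
  by_cases h : p2 = 0
  · exact ⟨1, 0, p0, p1, by ring, by ring, by rw [h]; ring⟩
  · obtain ⟨r, hr⟩ := IsAlgClosed.exists_pow_nat_eq (p1 ^ 2 - 4 * p2 * p0) (n := 2) (by norm_num)
    refine ⟨(p1 + r) / 2, p2, (p1 - r) / (2 * p2), 1, ?_, ?_, ?_⟩
    · field_simp; linear_combination hr
    · field_simp; ring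
    · ring

open Polynomial in
theorem avoid (P Q : ℂ[X]) (hP : P ≠ 0) (hQ : Q ≠ 0) (c : ℂ) :
    ∃ θ : ℂ, ∀ z z' : ℂ, P.eval z = 0 → Q.eval z' = 0 → z + c * z' ≠ θ := by
  obtain ⟨θ, hθ⟩ := Infinite.exists_notMem_finset
    ((P.roots.toFinset ×ˢ Q.roots.toFinset).image (fun z => z.1 + c * z.2))
  refine ⟨θ, fun z z' hz hz' h => hθ ?_⟩
  rw [Finset.mem_image]
  refine ⟨(z, z'), ?_, h⟩
  simp [hP, hQ, hz, hz']

end CubicPf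


set_option linter.unusedSimpArgs false

namespace CubicPf

variable {W : Type*} [AddCommGroup W] [Module ℂ W]

theorem diag [FiniteDimensional ℂ W] {n : ℕ} (U : Submodule ℂ W) (hU : Module.finrank ℂ U = n)
    (β : W →ₗ[ℂ] W →ₗ[ℂ] ℂ) (hβ : ∀ u v, β u v = β v u) :
    ∃ y : Fin n → W, LinearIndependent ℂ y ∧ (∀ i, y i ∈ U) ∧
      (∀ v ∈ U, ∃ c : Fin n → ℂ, v = ∑ i, c i • y i) ∧ (∀ i j, i ≠ j → β (y i) (y j) = 0) ∧
      (∀ i, β (y i) (y i) = 0 ∨ β (y i) (y i) = 1) ∧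
      (∀ i j, i ≤ j → β (y j) (y j) = 1 → β (y i) (y i) = 1) := by
  classical
  let β' : LinearMap.BilinForm ℂ U := (β.domRestrict₁₂ U U)
  have hβ' : ∀ u v : U, β' u v = β u v := fun u v => rfl
  obtain ⟨b0, hb0⟩ := LinearMap.BilinForm.exists_orthogonal_basis (B := β')
    (by constructor; intro u v; simp [hβ', hβ (u:W) v])
  have hb1 : ∀ i j, i ≠ j → β' (b0 i) (b0 j) = 0 := fun i j h => hb0 h
  let b1 := b0.reindex (finCongr hU)
  have hb1' : ∀ i j, i ≠ j → β' (b1 i) (b1 j) = 0 := by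
    intro i j h
    simp only [b1, Module.Basis.reindex_apply]
    exact hb1 _ _ (by simpa using h)
  let φ : Fin n → ℕ := fun i => if β' (b1 i) (b1 i) = 0 then 1 else 0
  let σ := Tuple.sort φ
  have hσ := Tuple.monotone_sort φ
  have hr : ∀ z : ℂ, ∃ r : ℂ, r ≠ 0 ∧ (r ^ 2 * z = 0 ∨ r ^ 2 * z = 1) ∧ (r ^ 2 * z = 1 ↔ z ≠ 0) := by
    intro z
    by_cases hz : z = 0
    · exact ⟨1, one_ne_zero, by simp [hz], by simp [hz]⟩
    · obtain ⟨r, hr⟩ := IsAlgClosed.exists_pow_nat_eq (z⁻¹) (n := 2) (by norm_num)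
      have h1 : r ^ 2 * z = 1 := by rw [hr]; field_simp
      refine ⟨r, ?_, Or.inr h1, by simp [h1, hz]⟩
      rintro rfl
      simp at h1
  choose r hr0 hr1 hr2 using hr
  let d : Fin n → ℂ := fun i => β' (b1 (σ i)) (b1 (σ i))
  let b2 : Module.Basis (Fin n) ℂ U := (b1.reindex σ.symm).isUnitSMul (w := fun i => r (d i))
    (fun i => (hr0 _).isUnit)
  have hb2 : ∀ i, b2 i = r (d i) • b1 (σ i) := by
    intro i; simp [b2, Module.Basis.isUnitSMul_apply]
  have hd : ∀ i, β' (b2 i) (b2 i) = r (d i) ^ 2 * d i := by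
    intro i; rw [hb2]; simp [d]; ring
  refine ⟨fun i => (b2 i : W), ?_, fun i => (b2 i).2, ?_, ?_, ?_, ?_⟩
  · exact b2.linearIndependent.map' U.subtype (Submodule.ker_subtype U)
  · intro v hv
    refine ⟨fun i => b2.repr ⟨v, hv⟩ i, ?_⟩
    have := congrArg (Submodule.subtype U) (b2.sum_repr ⟨v, hv⟩)
    rw [map_sum] at this
    exact this.symm
  · intro i j hij
    rw [← hβ', hb2, hb2]
    have := hb1' (σ i) (σ j) (by simpa using hij)
    simp [this]
  · intro i
    rw [← hβ', hd]; exact hr1 _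
  · intro i j hij h
    rw [← hβ', hd, hr2] at h ⊢
    have := hσ hij
    simp only [Function.comp, φ] at this
    intro h0
    have e1 : β' (b1 (Tuple.sort φ i)) (b1 (Tuple.sort φ i)) = 0 := h0
    have e2 : β' (b1 (Tuple.sort φ j)) (b1 (Tuple.sort φ j)) ≠ 0 := h
    simp only [φ] at e1 e2
    rw [if_pos e1, if_neg e2] at this
    omega

theorem compl_in [FiniteDimensional ℂ W] (o : W) (ho : o ≠ 0) (K : Submodule ℂ W) (hK : o ∈ K) :
    ∃ U : Submodule ℂ W, U ≤ K ∧ (∀ c : ℂ, c • o ∈ U → c = 0) ∧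
      (∀ v ∈ K, ∃ c : ℂ, ∃ u ∈ U, v = c • o + u) ∧ Module.finrank ℂ U + 1 = Module.finrank ℂ K := by
  obtain ⟨C, hC⟩ := Submodule.exists_isCompl (Submodule.span ℂ {o})
  have hle : Submodule.span ℂ {o} ≤ K := by simpa [Submodule.span_le] using hK
  have hinf : Submodule.span ℂ {o} ⊓ (C ⊓ K) = ⊥ := by
    rw [← inf_assoc, hC.inf_eq_bot]; simp
  have hsup : Submodule.span ℂ {o} ⊔ (C ⊓ K) = K := by
    rw [← sup_inf_assoc_of_le C hle, hC.sup_eq_top]; simp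
  refine ⟨C ⊓ K, inf_le_right, ?_, ?_, ?_⟩
  · intro c hc
    have : c • o ∈ Submodule.span ℂ {o} ⊓ (C ⊓ K) :=
      ⟨Submodule.smul_mem _ _ (Submodule.mem_span_singleton_self o), hc⟩
    rw [hinf] at this
    simpa [ho] using this
  · intro v hv
    rw [← hsup, Submodule.mem_sup] at hv
    obtain ⟨a, ha, u, hu, rfl⟩ := hv
    obtain ⟨c, rfl⟩ := Submodule.mem_span_singleton.mp ha
    exact ⟨c, u, hu, rfl⟩
  · have := Submodule.finrank_sup_add_finrank_inf_eq (Submodule.span ℂ {o}) (C ⊓ K)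
    rw [hsup, hinf, finrank_span_singleton ho] at this
    simp at this
    omega

theorem conic [FiniteDimensional ℂ W] (U : Submodule ℂ W) (hU : 3 ≤ Module.finrank ℂ U)
    (β : W →ₗ[ℂ] W →ₗ[ℂ] ℂ) (hβ : ∀ u v, β u v = β v u) :
    ∃ u0 u1 u2 : W, u0 ∈ U ∧ u1 ∈ U ∧ u2 ∈ U ∧ ∀ a b : ℂ,
      β (a ^ 2 • u0 + (a * b) • u1 + b ^ 2 • u2) (a ^ 2 • u0 + (a * b) • u1 + b ^ 2 • u2) = 0 ∧
      (a ^ 2 • u0 + (a * b) • u1 + b ^ 2 • u2 = 0 → a = 0 ∧ b = 0) := by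
  obtain ⟨n, hn⟩ : ∃ n, Module.finrank ℂ U = n + 3 := ⟨Module.finrank ℂ U - 3, by omega⟩
  obtain ⟨y, hy, hyU, -, ho, hd, hs⟩ := diag U hn β hβ
  have hmod : 2 % (n + 3) = 2 := Nat.mod_eq_of_lt (by omega)
  have i01 : (0 : Fin (n+3)) ≠ 1 := by simp [Fin.ext_iff]
  have i02 : (0 : Fin (n+3)) ≠ 2 := by simp [Fin.ext_iff, Fin.val_ofNat, hmod]
  have i12 : (1 : Fin (n+3)) ≠ 2 := by simp [Fin.ext_iff, Fin.val_ofNat, hmod]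
  have li : ∀ x0 x1 x2 : ℂ, x0 • y 0 + x1 • y 1 + x2 • y 2 = 0 → x0 = 0 ∧ x1 = 0 ∧ x2 = 0 := by
    have h3 : LinearIndependent ℂ ![y 0, y 1, y 2] := by
      have := hy.comp ![0, 1, 2] (by
        intro i j h
        fin_cases i <;> fin_cases j <;> simp_all [i01.symm, i02.symm, i12.symm])
      convert this using 1
      ext i; fin_cases i <;> rfl
    intro x0 x1 x2 h
    have := Fintype.linearIndependent_iff.mp h3 ![x0, x1, x2] (by simpa [Fin.sum_univ_three] using h)
    exact ⟨this 0, this 1, this 2⟩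
  have h01 := ho 0 1 i01
  have h02 := ho 0 2 i02
  have h12 := ho 1 2 i12
  have h10 := ho 1 0 i01.symm
  have h20 := ho 2 0 i02.symm
  have h21 := ho 2 1 i12.symm
  have hI : Complex.I * Complex.I = -1 := Complex.I_mul_I
  rcases hd 2 with h2 | h2
  · rcases hd 1 with h1 | h1
    · refine ⟨y 1, 0, y 2, hyU _, Submodule.zero_mem _, hyU _, fun a b => ⟨?_, fun h => ?_⟩⟩
      · simp [h1, h2, h12, h21]
      · have := li 0 (a ^ 2) (b ^ 2) (by rw [← h]; module)
        simpa using this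
    · have h0 := hs 0 1 (by simp [Fin.le_def]) h1
      refine ⟨y 0 + Complex.I • y 1, 0, y 2, Submodule.add_mem _ (hyU _)
        (Submodule.smul_mem _ _ (hyU _)), Submodule.zero_mem _, hyU _, fun a b => ⟨?_, fun h => ?_⟩⟩
      · simp [h1, h2, h12, h21, h0, h01, h10, h02, h20]
        linear_combination a ^ 4 * hI
      · have := li (a ^ 2) (a ^ 2 * Complex.I) (b ^ 2) (by rw [← h]; module)
        simpa using this
  · have h1 := hs 1 2 (by simp [Fin.le_def, Fin.val_ofNat, hmod]) h2
    have h0 := hs 0 2 (by simp [Fin.le_def, Fin.val_ofNat, hmod]) h2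
    refine ⟨y 0 + Complex.I • y 1, (2 * Complex.I) • y 2, y 0 - Complex.I • y 1,
      Submodule.add_mem _ (hyU _) (Submodule.smul_mem _ _ (hyU _)), Submodule.smul_mem _ _ (hyU _),
      Submodule.sub_mem _ (hyU _) (Submodule.smul_mem _ _ (hyU _)), fun a b => ⟨?_, fun h => ?_⟩⟩
    · simp [h1, h2, h12, h21, h0, h01, h10, h02, h20]
      linear_combination (4 * a ^ 2 * b ^ 2 + (a ^ 2 - b ^ 2) ^ 2) * hI
    · have := li (a ^ 2 + b ^ 2) (Complex.I * (a ^ 2 - b ^ 2)) (2 * Complex.I * a * b)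
        (by rw [← h]; module)
      obtain ⟨e1, e2, e3⟩ := this
      have e2' : a ^ 2 - b ^ 2 = 0 := by simpa using e2
      exact ⟨by have : a ^ 2 = 0 := by linear_combination (e1 + e2') / 2
                simpa using this,
             by have : b ^ 2 = 0 := by linear_combination (e1 - e2') / 2
                simpa using this⟩

theorem line [FiniteDimensional ℂ W] (hW : Module.finrank ℂ W = 5)
    (T : W →ₗ[ℂ] W →ₗ[ℂ] W →ₗ[ℂ] ℂ) (hT : SymT T) (p : W) (hp : p ≠ 0) (hf : T p p p = 0) :
    ∃ v, (∀ c : ℂ, v ≠ c • p) ∧ T p p v = 0 ∧ T p v v = 0 ∧ T v v v = 0 := by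
  obtain ⟨U, hUK, hU0, -, hUd⟩ := compl_in p hp (LinearMap.ker (T p p)) hf
  have h3 : 3 ≤ Module.finrank ℂ U := by
    have h1 := LinearMap.finrank_range_add_finrank_ker (T p p)
    have h2 := Submodule.finrank_le (LinearMap.range (T p p))
    rw [Module.finrank_self] at h2
    omega
  obtain ⟨u0, u1, u2, m0, m1, m2, h⟩ := conic U h3 (T p) (fun u v => hT.2 p u v)
  obtain ⟨b, a, hab, hr⟩ := binroot6 (T u0 u0 u0) (3 * T u0 u0 u1) (3 * T u0 u0 u2 + 3 * T u0 u1 u1)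
    (6 * T u0 u1 u2 + T u1 u1 u1) (3 * T u0 u2 u2 + 3 * T u1 u1 u2) (3 * T u1 u2 u2) (T u2 u2 u2)
  have hm : a ^ 2 • u0 + (a * b) • u1 + b ^ 2 • u2 ∈ U :=
    Submodule.add_mem _ (Submodule.add_mem _ (Submodule.smul_mem _ _ m0) (Submodule.smul_mem _ _ m1))
      (Submodule.smul_mem _ _ m2)
  refine ⟨a ^ 2 • u0 + (a * b) • u1 + b ^ 2 • u2, ?_, hUK hm, (h a b).1, ?_⟩
  · intro c hc
    have := hU0 c (hc ▸ hm)
    rw [this, zero_smul] at hc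
    have := (h a b).2 hc
    tauto
  · rw [exp3 hT]; linear_combination hr

theorem thmC [FiniteDimensional ℂ W] (hW : Module.finrank ℂ W = 5)
    (T : W →ₗ[ℂ] W →ₗ[ℂ] W →ₗ[ℂ] ℂ) (hT : SymT T)
    (s : W →ₗ[ℂ] ℂ) (B : Fin 3 → Fin 3 → (W →ₗ[ℂ] ℂ))
    (hB : ∀ v, s v = 0 → T v v v = det3 (fun i j => B i j v))
    (p : W) (hsp : s p = 0) (hf : T p p p = 0) (φ : W →ₗ[ℂ] ℂ) (hφ : φ p = 1)
    (hno : ∀ v, s v = 0 → φ v = 0 → T p p v = 0 → T p v v = 0 → T v v v = 0 → v = 0) :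
    IsPf (fun v => T v v v) := by
  have hp : p ≠ 0 := by rintro rfl; simp at hφ
  have hno' : ∀ v, s v = 0 → T p p v = 0 → T p v v = 0 → T v v v = 0 → ∃ c : ℂ, v = c • p := by
    intro v h0 h1 h2 h3
    refine ⟨φ v, ?_⟩
    have hc := cubic_add hT v ((-φ v) • p)
    have := hno (v + (-φ v) • p) (by simp [h0, hsp]) (by simp [hφ]) (by simp [h1, hf])
      (by simp [h1, h2, hf, hT.2 p v p]) (by
        rw [hc]
        simp only [map_smul, LinearMap.smul_apply, smul_eq_mul, h3, hf]
        rw [hT.2 v v p, hT.1 v p v, hT.1 v p p, hT.2 p v p, h1, h2]; ring)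
    have e : v = (v + (-φ v) • p) + φ v • p := by module
    rw [this, zero_add] at e
    exact e
  have hdet : (Matrix.of (fun i j => B i j p)).det = 0 := by
    have := hB p hsp
    rw [hf] at this
    rw [Matrix.det_fin_three]
    simp only [det3] at this
    simp only [Matrix.of_apply]
    linear_combination -this
  obtain ⟨a, ha0, ha⟩ := Matrix.exists_vecMul_eq_zero_iff.mpr hdet
  have hbp : ∀ j, ∑ i, a i * B i j p = 0 := by
    intro j; have := congrFun ha j
    simpa [Matrix.vecMul, dotProduct] using this
  obtain ⟨w, hw, w1, w2, w3⟩ := line hW T hT p hp hf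
  have hsw : s w ≠ 0 := by
    intro h
    obtain ⟨c, hc⟩ := hno' w h w1 w2 w3
    exact hw c hc
  refine engine hW T hT s B hB a p ((s w)⁻¹ • w) ?_ (by simp [hsw]) (by simp [w1]) (by simp [w2])
    (by simp [w3]) hsp hbp
  intro v hv hvb
  have hz : ∀ β : ℂ, T (p + β • v) (p + β • v) (p + β • v) = 0 := by
    intro β
    rw [hB _ (by simp [hv, hsp])]
    have : (Matrix.of (fun i j => B i j (p + β • v))).det = 0 := by
      apply Matrix.exists_vecMul_eq_zero_iff.mp
      refine ⟨a, ha0, ?_⟩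
      ext j
      have e1 := hbp j
      have e2 := hvb j
      simp only [Fin.sum_univ_three] at e1 e2
      simp [Matrix.vecMul, dotProduct, Fin.sum_univ_three]
      linear_combination e1 + β * e2
    rw [Matrix.det_fin_three] at this
    simp only [Matrix.of_apply] at this
    simp only [det3]
    linear_combination this
  have hz' : ∀ β : ℂ, 3 * β * T p p v + 3 * β ^ 2 * T p v v + β ^ 3 * T v v v = 0 := by
    intro β
    have := hz β
    rw [cubic_add hT] at this
    simp only [map_smul, LinearMap.smul_apply, smul_eq_mul, hf] at this
    linear_combination this
  have z1 := hz' 1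
  have z2 := hz' (-1)
  have z3 := hz' 2
  apply hno' v hv
  · linear_combination z1 / 3 - z2 / 9 - z3 / 18
  · linear_combination z1 / 6 + z2 / 6
  · linear_combination -z1 / 2 - z2 / 6 + z3 / 6

end CubicPf


set_option linter.unusedSimpArgs false

namespace CubicPf

variable {W : Type*} [AddCommGroup W] [Module ℂ W]

/-- linear form with given coefficients -/
def lf (c : Fin 4 → ℂ) (x0 x1 x2 x3 : ℂ) : ℂ := c 0 * x0 + c 1 * x1 + c 2 * x2 + c 3 * x3

/-- nice determinantal representation of a quaternary cubic -/
def HasDet (g : ℂ → ℂ → ℂ → ℂ → ℂ) : Prop := ∃ B : Fin 3 → Fin 3 → Fin 4 → ℂ,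
  (∀ x0 x1 x2 x3, g x0 x1 x2 x3 = det3 (fun i j => lf (B i j) x0 x1 x2 x3)) ∧
  ∃ a : Fin 3 → ℂ, (∀ j, ∑ i, a i * B i j 0 = 0) ∧
    ∀ x0 x1 x2 x3, (∀ j, ∑ i, a i * lf (B i j) x0 x1 x2 x3 = 0) → x1 = 0 ∧ x2 = 0 ∧ x3 = 0

theorem hasDet_I (m1 m2 m3 m4 m5 m6 m7 m8 m9 m10 : ℂ) : HasDet (fun x0 x1 x2 x3 =>
    3 * x0 * (x1 * x3 - x2 ^ 2) + m1 * x1 ^ 3 + m2 * x1 ^ 2 * x2 + m3 * x1 ^ 2 * x3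
      + m4 * x1 * x2 ^ 2 + m5 * x1 * x2 * x3 + m6 * x1 * x3 ^ 2 + m7 * x2 ^ 3 + m8 * x2 ^ 2 * x3
      + m9 * x2 * x3 ^ 2 + m10 * x3 ^ 3) := by
  obtain ⟨c0, c1, c2, c3, d0, d1, d2, d3, hc, p0, p1, p2, p3, p4, p5, p6⟩ :=
    fac6 m1 m2 (m3 + m4) (m5 + m7) (m6 + m8) m9 m10
  refine ⟨![![![0, 1, 0, 0], ![0, 0, 1, 0], ![0, 0, -c2, -c3]],
    ![![0, 0, 1, 0], ![0, 0, 0, 1], ![0, c0, c1, 0]],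
    ![![0, 0, d2, d3], ![0, -d0, -d1, 0], ![3, m3, m5 - c3 * d0 - c0 * d3, m6]]], ?_, ?_⟩
  · intro x0 x1 x2 x3
    simp [det3, lf]
    linear_combination x1 ^ 3 * p0 + x1 ^ 2 * x2 * p1 + x1 * x2 ^ 2 * p2 + x2 ^ 3 * p3
      + x2 ^ 2 * x3 * p4 + x2 * x3 ^ 2 * p5 + x3 ^ 3 * p6
  · obtain ⟨z, hz⟩ : ∃ z : ℂ, c0 + c1 * z + c2 * z ^ 2 + c3 * z ^ 3 ≠ 0 := by
      by_contra hcon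
      push Not at hcon
      have z0 := hcon 0
      have z1 := hcon 1
      have z2 := hcon (-1)
      have z3 := hcon 2
      apply hc
      have e0 : c0 = 0 := by linear_combination z0
      have e2 : c2 = 0 := by linear_combination (z1 + z2) / 2 - z0
      have e3 : c3 = 0 := by linear_combination (z3 - 4 * e2 - e0 - (z1 - z2)) / 6
      have e1 : c1 = 0 := by linear_combination z1 - e0 - e2 - e3
      exact ⟨e0, e1, e2, e3⟩
    refine ⟨![-z, 1, 0], ?_, ?_⟩
    · intro j; fin_cases j <;> simp [Fin.sum_univ_three]
    · intro x0 x1 x2 x3 h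
      have h0 := h 0
      have h1 := h 1
      have h2 := h 2
      simp [Fin.sum_univ_three, lf] at h0 h1 h2
      have e2 : x2 = z * x1 := by linear_combination h0
      have e3 : x3 = z * x2 := by linear_combination h1
      have : (c0 + c1 * z + c2 * z ^ 2 + c3 * z ^ 3) * x1 = 0 := by
        rw [e3, e2] at h2; linear_combination h2
      have e1 : x1 = 0 := by simpa [hz] using this
      rw [e1] at e2
      have e2' : x2 = 0 := by linear_combination e2
      exact ⟨e1, e2', by rw [e3, e2']; ring⟩

theorem hasDet_II (ρ m1 m2 m3 m4 m5 m6 m8 m9 m10 : ℂ) : HasDet (fun x0 x1 x2 x3 =>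
    ρ * x0 * x1 * x2 + m1 * x1 ^ 3 + m2 * x1 ^ 2 * x2 + m3 * x1 ^ 2 * x3
      + m4 * x1 * x2 ^ 2 + m5 * x1 * x2 * x3 + m6 * x1 * x3 ^ 2 + m8 * x2 ^ 2 * x3
      + m9 * x2 * x3 ^ 2 + m10 * x3 ^ 3) := by
  obtain ⟨h0, h1, g0, g1, g2, hc, p0, p1, p2, p3⟩ := fac3 m1 m3 m6 m10
  refine ⟨![![![0, 0, 1, 0], ![0, 0, 0, g2], ![0, -g0, 0, -g1]],
    ![![0, 0, 0, 0], ![0, 1, 0, 0], ![0, 0, 0, 1]],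
    ![![0, h0, 0, h1], ![0, 0, -m8, -m9], ![ρ, m2, m4, m5]]], ?_, ?_⟩
  · intro x0 x1 x2 x3
    simp [det3, lf]
    linear_combination x1 ^ 3 * p0 + x1 ^ 2 * x3 * p1 + x1 * x3 ^ 2 * p2 + x3 ^ 3 * p3
  · obtain ⟨μ, hμ⟩ : ∃ μ : ℂ, μ ^ 2 - g1 * μ + g0 * g2 ≠ 0 := by
      by_contra hcon
      push Not at hcon
      have z0 := hcon 0
      have z1 := hcon 1
      have z2 := hcon (-1)
      have : (1:ℂ) = 0 := by linear_combination (z1 + z2) / 2 - z0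
      exact one_ne_zero this
    refine ⟨![1, μ, 0], ?_, ?_⟩
    · intro j; fin_cases j <;> simp [Fin.sum_univ_three]
    · intro x0 x1 x2 x3 h
      have h0 := h 0
      have h1 := h 1
      have h2 := h 2
      simp [Fin.sum_univ_three, lf] at h0 h1 h2
      have e1 : (μ ^ 2 - g1 * μ + g0 * g2) * x1 = 0 := by
        linear_combination (μ - g1) * h1 - g2 * h2
      have e3 : (μ ^ 2 - g1 * μ + g0 * g2) * x3 = 0 := by
        linear_combination g0 * h1 + μ * h2
      exact ⟨by simpa [hμ] using e1, h0, by simpa [hμ] using e3⟩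

theorem hasDet_III (ρ m1 m2 m3 m5 m6 m8 m9 : ℂ) : HasDet (fun x0 x1 x2 x3 =>
    ρ * x0 * x1 ^ 2 + m1 * x1 ^ 3 + m2 * x1 ^ 2 * x2 + m3 * x1 ^ 2 * x3
      + m5 * x1 * x2 * x3 + m6 * x1 * x3 ^ 2 + m8 * x2 ^ 2 * x3
      + m9 * x2 * x3 ^ 2) := by
  refine ⟨![![![0, 0, 0, 1], ![0, 0, 0, 0], ![0, -1, 0, 0]],
    ![![0, 0, 0, 0], ![0, 1, 0, 0], ![0, 0, 1, 0]],
    ![![ρ, m1, m2, m3], ![0, 0, -m8, -m9], ![0, 0, m5, m6]]], ?_, ![1, 1, 0], ?_, ?_⟩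
  · intro x0 x1 x2 x3
    simp [det3, lf]
    ring
  · intro j; fin_cases j <;> simp [Fin.sum_univ_three]
  · intro x0 x1 x2 x3 h
    have h0 := h 0
    have h1 := h 1
    have h2 := h 2
    simp [Fin.sum_univ_three, lf] at h0 h1 h2
    exact ⟨h1, by linear_combination h2 + h1, h0⟩

/-- restriction to a 4 space -/
def G4 (T : W →ₗ[ℂ] W →ₗ[ℂ] W →ₗ[ℂ] ℂ) (o e1 e2 e3 : W) : ℂ → ℂ → ℂ → ℂ → ℂ :=
  fun x0 x1 x2 x3 => T (x0 • o + x1 • e1 + x2 • e2 + x3 • e3) (x0 • o + x1 • e1 + x2 • e2 + x3 • e3)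
    (x0 • o + x1 • e1 + x2 • e2 + x3 • e3)

theorem det_I {T : W →ₗ[ℂ] W →ₗ[ℂ] W →ₗ[ℂ] ℂ} (hT : SymT T) {o e1 e2 e3 : W}
    (h0 : T o o o = 0) (h1 : T o o e1 = 0) (h2 : T o o e2 = 0) (h3 : T o o e3 = 0)
    (h11 : T o e1 e1 = 0) (h12 : T o e1 e2 = 0) (h13 : T o e1 e3 = 1 / 2) (h22 : T o e2 e2 = -1)
    (h23 : T o e2 e3 = 0) (h33 : T o e3 e3 = 0) : HasDet (G4 T o e1 e2 e3) := by
  convert hasDet_I (T e1 e1 e1) (3 * T e1 e1 e2) (3 * T e1 e1 e3) (3 * T e1 e2 e2)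
    (6 * T e1 e2 e3) (3 * T e1 e3 e3) (T e2 e2 e2) (3 * T e2 e2 e3) (3 * T e2 e3 e3)
    (T e3 e3 e3) using 5 with x0 x1 x2 x3
  rw [G4, exp4 hT, h0, h1, h2, h3, h11, h12, h13, h22, h23, h33]
  ring

theorem det_II {T : W →ₗ[ℂ] W →ₗ[ℂ] W →ₗ[ℂ] ℂ} (hT : SymT T) {o e1 e2 e3 : W}
    (h0 : T o o o = 0) (h1 : T o o e1 = 0) (h2 : T o o e2 = 0) (h3 : T o o e3 = 0)
    (h11 : T o e1 e1 = 0) (h13 : T o e1 e3 = 0) (h22 : T o e2 e2 = 0)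
    (h23 : T o e2 e3 = 0) (h33 : T o e3 e3 = 0) (h : T e2 e2 e2 = 0) :
    HasDet (G4 T o e1 e2 e3) := by
  convert hasDet_II (6 * T o e1 e2) (T e1 e1 e1) (3 * T e1 e1 e2) (3 * T e1 e1 e3) (3 * T e1 e2 e2)
    (6 * T e1 e2 e3) (3 * T e1 e3 e3) (3 * T e2 e2 e3) (3 * T e2 e3 e3)
    (T e3 e3 e3) using 5 with x0 x1 x2 x3
  rw [G4, exp4 hT, h0, h1, h2, h3, h11, h13, h22, h23, h33, h]
  ring

theorem det_III {T : W →ₗ[ℂ] W →ₗ[ℂ] W →ₗ[ℂ] ℂ} (hT : SymT T) {o e1 e2 e3 : W}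
    (h0 : T o o o = 0) (h1 : T o o e1 = 0) (h2 : T o o e2 = 0) (h3 : T o o e3 = 0)
    (h12 : T o e1 e2 = 0) (h13 : T o e1 e3 = 0) (h22 : T o e2 e2 = 0)
    (h23 : T o e2 e3 = 0) (h33 : T o e3 e3 = 0) (h : T e2 e2 e2 = 0) (h' : T e1 e2 e2 = 0)
    (h'' : T e3 e3 e3 = 0) :
    HasDet (G4 T o e1 e2 e3) := by
  convert hasDet_III (3 * T o e1 e1) (T e1 e1 e1) (3 * T e1 e1 e2) (3 * T e1 e1 e3)
    (6 * T e1 e2 e3) (3 * T e1 e3 e3) (3 * T e2 e2 e3) (3 * T e2 e3 e3) using 5 with x0 x1 x2 x3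
  rw [G4, exp4 hT, h0, h1, h2, h3, h12, h13, h22, h23, h33, h, h', h'']
  ring

theorem singPf [FiniteDimensional ℂ W] (hW : Module.finrank ℂ W = 5)
    (T : W →ₗ[ℂ] W →ₗ[ℂ] W →ₗ[ℂ] ℂ) (hT : SymT T) {o e1 e2 e3 w : W} (hs : Sp o e1 e2 e3 w)
    (ho : ∀ v, T o o v = 0) (h1 : T o w w = 0) (h2 : T w w w = 0) (hd : HasDet (G4 T o e1 e2 e3)) :
    IsPf (fun v => T v v v) := by
  obtain ⟨x, hx, hx'⟩ := hs.coord hW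
  obtain ⟨B, hB, a, ha0, ha⟩ := hd
  have ho' : ∀ i, x i o = ![1, 0, 0, 0, 0] i := by
    intro i; have := hx' i 1 0 0 0 0; simpa using this
  have hw' : ∀ i, x i w = ![0, 0, 0, 0, 1] i := by
    intro i; have := hx' i 0 0 0 0 1; simpa using this
  let B' : Fin 3 → Fin 3 → (W →ₗ[ℂ] ℂ) := fun i j =>
    B i j 0 • x 0 + B i j 1 • x 1 + B i j 2 • x 2 + B i j 3 • x 3
  have hB' : ∀ i j v, B' i j v = lf (B i j) (x 0 v) (x 1 v) (x 2 v) (x 3 v) := by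
    intro i j v; simp [B', lf]
  have hx4 : ∀ v, x 4 v = 0 → v = x 0 v • o + x 1 v • e1 + x 2 v • e2 + x 3 v • e3 := by
    intro v hv
    have := hx v
    rw [hv, zero_smul, add_zero] at this
    exact this
  refine engine hW T hT (x 4) B' ?_ a o w ?_ (by simp [hw']) (ho w) h1 h2 (by simp [ho']) ?_
  · intro v hv
    have := hB (x 0 v) (x 1 v) (x 2 v) (x 3 v)
    rw [G4, ← hx4 v hv] at this
    simp only [hB']; exact this
  · intro v hv h
    simp only [hB'] at h
    obtain ⟨z1, z2, z3⟩ := ha _ _ _ _ h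
    refine ⟨x 0 v, ?_⟩
    have := hx4 v hv
    rw [z1, z2, z3] at this
    simpa using this
  · intro j
    rw [← ha0 j]
    simp [hB', ho', lf]

theorem smoothPf [FiniteDimensional ℂ W] (hW : Module.finrank ℂ W = 5)
    (T : W →ₗ[ℂ] W →ₗ[ℂ] W →ₗ[ℂ] ℂ) (hT : SymT T) {o e1 e2 e3 w : W} (hs : Sp o e1 e2 e3 w)
    (hd : HasDet (G4 T o e1 e2 e3)) (p0 p1 p2 p3 c1 c2 c3 : ℂ) (hc : c1 * p1 + c2 * p2 + c3 * p3 = 1)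
    (hf : G4 T o e1 e2 e3 p0 p1 p2 p3 = 0)
    (hno : ∀ y0 y1 y2 y3 : ℂ, c1 * y1 + c2 * y2 + c3 * y3 = 0 →
      T (p0 • o + p1 • e1 + p2 • e2 + p3 • e3) (p0 • o + p1 • e1 + p2 • e2 + p3 • e3)
        (y0 • o + y1 • e1 + y2 • e2 + y3 • e3) = 0 →
      T (p0 • o + p1 • e1 + p2 • e2 + p3 • e3) (y0 • o + y1 • e1 + y2 • e2 + y3 • e3)
        (y0 • o + y1 • e1 + y2 • e2 + y3 • e3) = 0 →
      G4 T o e1 e2 e3 y0 y1 y2 y3 = 0 →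
      (∀ c d : ℂ, G4 T o e1 e2 e3 (c * p0 + d * y0) (c * p1 + d * y1) (c * p2 + d * y2)
        (c * p3 + d * y3) = 0) → y0 = 0 ∧ y1 = 0 ∧ y2 = 0 ∧ y3 = 0) :
    IsPf (fun v => T v v v) := by
  obtain ⟨x, hx, hx'⟩ := hs.coord hW
  obtain ⟨B, hB, -⟩ := hd
  let B' : Fin 3 → Fin 3 → (W →ₗ[ℂ] ℂ) := fun i j =>
    B i j 0 • x 0 + B i j 1 • x 1 + B i j 2 • x 2 + B i j 3 • x 3
  have hB' : ∀ i j v, B' i j v = lf (B i j) (x 0 v) (x 1 v) (x 2 v) (x 3 v) := by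
    intro i j v; simp [B', lf]
  have hx4 : ∀ v, x 4 v = 0 → v = x 0 v • o + x 1 v • e1 + x 2 v • e2 + x 3 v • e3 := by
    intro v hv
    have := hx v
    rw [hv, zero_smul, add_zero] at this
    exact this
  have hp : ∀ i, x i (p0 • o + p1 • e1 + p2 • e2 + p3 • e3) = ![p0, p1, p2, p3, 0] i := by
    intro i; have := hx' i p0 p1 p2 p3 0; rwa [zero_smul, add_zero] at this
  refine thmC hW T hT (x 4) B' ?_ (p0 • o + p1 • e1 + p2 • e2 + p3 • e3) (by rw [hp]; rfl) hf
    (c1 • x 1 + c2 • x 2 + c3 • x 3) ?_ ?_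
  · intro v hv
    have := hB (x 0 v) (x 1 v) (x 2 v) (x 3 v)
    rw [G4, ← hx4 v hv] at this
    simp only [hB']; exact this
  · simp only [LinearMap.add_apply, LinearMap.smul_apply, smul_eq_mul, hp]
    simpa using hc
  · intro v hv hφ q1 q2 q3
    have hv' := hx4 v hv
    have q := hno (x 0 v) (x 1 v) (x 2 v) (x 3 v) (by simpa using hφ) (by rw [← hv']; exact q1)
      (by rw [← hv']; exact q2) (by rw [G4, ← hv']; exact q3) (by
        intro c d
        have e : (c * p0 + d * x 0 v) • o + (c * p1 + d * x 1 v) • e1 + (c * p2 + d * x 2 v) • e2 +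
          (c * p3 + d * x 3 v) • e3 = c • (p0 • o + p1 • e1 + p2 • e2 + p3 • e3) + d • v := by
          conv_rhs => rw [hv']
          module
        rw [G4, e, cubic_add hT]
        rw [G4] at hf
        simp only [map_smul, LinearMap.smul_apply, smul_eq_mul, hf, q1, q2, q3]
        ring)
    rw [hv', q.1, q.2.1, q.2.2.1, q.2.2.2]; simp

end CubicPf


set_option linter.unusedSimpArgs false

namespace CubicPf

variable {W : Type*} [AddCommGroup W] [Module ℂ W]

/-- rank at least 3, singular -/
theorem sing3 [FiniteDimensional ℂ W] (hW : Module.finrank ℂ W = 5)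
    (T : W →ₗ[ℂ] W →ₗ[ℂ] W →ₗ[ℂ] ℂ) (hT : SymT T) {o y1 y2 y3 y4 : W} (hs : Sp o y1 y2 y3 y4)
    (ho0 : o ≠ 0)
    (ho : ∀ v, T o o v = 0) (h12 : T o y1 y2 = 0) (h13 : T o y1 y3 = 0) (h14 : T o y1 y4 = 0)
    (h23 : T o y2 y3 = 0) (h24 : T o y2 y4 = 0) (h34 : T o y3 y4 = 0)
    (h11 : T o y1 y1 = 1) (h22 : T o y2 y2 = 1) (h33 : T o y3 y3 = 1) :
    IsPf (fun v => T v v v) := by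
  have sy := hT.2 o
  have h21 := (sy y2 y1).trans h12
  have h31 := (sy y3 y1).trans h13
  have h41 := (sy y4 y1).trans h14
  have h32 := (sy y3 y2).trans h23
  have h42 := (sy y4 y2).trans h24
  have h43 := (sy y4 y3).trans h34
  obtain ⟨δ, h44⟩ : ∃ δ, T o y4 y4 = δ := ⟨_, rfl⟩
  have hI : Complex.I * Complex.I = -1 := Complex.I_mul_I
  obtain ⟨P', hP', -, hPP', hP3'⟩ := line hW T hT o ho0 (ho o)
  obtain ⟨c, a1, a2, a3, a4, hP⟩ := hs P'
  obtain ⟨P, hPd⟩ : ∃ P, P = a1 • y1 + a2 • y2 + a3 • y3 + a4 • y4 := ⟨_, rfl⟩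
  have hP'P : P = P' + (-c) • o := by rw [hPd, hP]; module
  have hPP : T o P P = 0 := by
    rw [hP'P]; simp [hPP', ho, sy P' o]
  have hP3 : T P P P = 0 := by
    rw [hP'P, cubic_add hT]
    simp [hP3', ho, hT.2 P' P' o, hT.1 P' o P', hT.1 P' o o, hT.2 o P' o, hPP']
  have hPq : a1 ^ 2 + a2 ^ 2 + a3 ^ 2 + δ * a4 ^ 2 = 0 := by
    rw [hPd] at hPP
    simp [h12, h13, h14, h23, h24, h34, h11, h22, h33, h44, h21, h31, h41, h32, h42, h43] at hPP
    linear_combination hPP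
  by_cases h4 : a4 = 0
  · have ha : a1 ^ 2 + a2 ^ 2 + a3 ^ 2 = 0 := by rw [h4] at hPq; linear_combination hPq
    obtain ⟨z1, z2, z3, hz, haz⟩ : ∃ z1 z2 z3 : ℂ, z1 ^ 2 + z2 ^ 2 + z3 ^ 2 = 0 ∧
        a1 * z1 + a2 * z2 + a3 * z3 = 1 := by
      have hN : a1 * star a1 + a2 * star a2 + a3 * star a3 ≠ 0 := by
        intro h
        have hh : Complex.normSq a1 + Complex.normSq a2 + Complex.normSq a3 = 0 := by
          have : ((Complex.normSq a1 + Complex.normSq a2 + Complex.normSq a3 : ℝ) : ℂ) = 0 := by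
            push_cast
            rw [← h, Complex.normSq_eq_conj_mul_self, Complex.normSq_eq_conj_mul_self,
              Complex.normSq_eq_conj_mul_self]
            simp only [starRingEnd_apply]
            ring
          exact_mod_cast this
        have n1 := Complex.normSq_nonneg a1
        have n2 := Complex.normSq_nonneg a2
        have n3 := Complex.normSq_nonneg a3
        have e1 : a1 = 0 := Complex.normSq_eq_zero.mp (by linarith)
        have e2 : a2 = 0 := Complex.normSq_eq_zero.mp (by linarith)
        have e3 : a3 = 0 := Complex.normSq_eq_zero.mp (by linarith)
        apply hP' c
        rw [hP, e1, e2, e3, h4]; simp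
      have ha' : star a1 ^ 2 + star a2 ^ 2 + star a3 ^ 2 = 0 := by
        have := congrArg star ha
        simpa using this
      set N := a1 * star a1 + a2 * star a2 + a3 * star a3 with hNd
      refine ⟨star a1 / N, star a2 / N, star a3 / N, ?_, ?_⟩
      · field_simp; linear_combination ha'
      · field_simp; rw [hNd]
    rw [h4] at hPd
    have hPd' : P = a1 • y1 + a2 • y2 + a3 • y3 := by rw [hPd]; simp
    -- cross product
    obtain ⟨c1, hc1⟩ : ∃ c1, c1 = a2 * z3 - a3 * z2 := ⟨_, rfl⟩
    obtain ⟨c2, hc2⟩ : ∃ c2, c2 = a3 * z1 - a1 * z3 := ⟨_, rfl⟩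
    obtain ⟨c3, hc3⟩ : ∃ c3, c3 = a1 * z2 - a2 * z1 := ⟨_, rfl⟩
    obtain ⟨e1, he1⟩ : ∃ e1, e1 = z1 • y1 + z2 • y2 + z3 • y3 := ⟨_, rfl⟩
    obtain ⟨e2, he2⟩ : ∃ e2, e2 = c1 • y1 + c2 • y2 + c3 • y3 := ⟨_, rfl⟩
    obtain ⟨e3, he3⟩ : ∃ e3, e3 = (1 / 2 : ℂ) • y4 + (1 / 2 : ℂ) • P + (-δ / 4) • e1 := ⟨_, rfl⟩
    have gen : ∀ u1 u2 u3 v1 v2 v3 : ℂ, T o (u1 • y1 + u2 • y2 + u3 • y3)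
        (v1 • y1 + v2 • y2 + v3 • y3) = u1 * v1 + u2 * v2 + u3 * v3 := by
      intro u1 u2 u3 v1 v2 v3
      simp [h12, h13, h14, h23, h24, h34, h11, h22, h33, h44, h21, h31, h41, h32, h42, h43]
    have gen4 : ∀ u1 u2 u3 : ℂ, T o (u1 • y1 + u2 • y2 + u3 • y3) y4 = 0 := by
      intro u1 u2 u3
      simp [h12, h13, h14, h23, h24, h34, h11, h22, h33, h44, h21, h31, h41, h32, h42, h43]
    have t11 : T o e1 e1 = 0 := by rw [he1, gen]; linear_combination hz
    have t12 : T o e1 e2 = 0 := by rw [he1, he2, gen, hc1, hc2, hc3]; ring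
    have t22 : T o e2 e2 = -1 := by
      rw [he2, gen, hc1, hc2, hc3]
      linear_combination (z1 ^ 2 + z2 ^ 2 + z3 ^ 2) * ha - (a1 * z1 + a2 * z2 + a3 * z3 + 1) * haz
    have t1P : T o e1 P = 1 := by rw [he1, hPd', gen]; linear_combination haz
    have t2P : T o e2 P = 0 := by rw [he2, hPd', gen, hc1, hc2, hc3]; ring
    have t14 : T o e1 y4 = 0 := by rw [he1, gen4]
    have t24 : T o e2 y4 = 0 := by rw [he2, gen4]
    have tP4 : T o P y4 = 0 := by rw [hPd', gen4]
    have t13 : T o e1 e3 = 1 / 2 := by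
      rw [he3]; simp [t14, t1P, t11]
    have t23 : T o e2 e3 = 0 := by
      rw [he3]; simp [t24, t2P, (sy e2 e1).trans t12]
    have t33 : T o e3 e3 = 0 := by
      rw [he3]; simp [t14, t1P, t11, tP4, hPP, h44, sy y4 P, sy y4 e1, sy P e1]
      ring
    have hs' : Sp o e1 e2 e3 P := by
      refine hs.chg o e1 e2 e3 P ⟨1, 0, 0, 0, 0, by module⟩ ⟨0, a1, -c1, 0, z1, ?_⟩
        ⟨0, a2, -c2, 0, z2, ?_⟩ ⟨0, a3, -c3, 0, z3, ?_⟩ ⟨0, δ / 2, 0, 2, -1, ?_⟩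
      · have k1 : a1 * z1 - c1 * c1 + z1 * a1 = 1 := by
          rw [hc1]
          linear_combination (z1 * z1 - (z1 ^ 2 + z2 ^ 2 + z3 ^ 2)) * ha + a1 * a1 * hz
            + (-(a1 * z1 + z1 * a1) + (a1 * z1 + a2 * z2 + a3 * z3 + 1)) * haz
        have k2 : a1 * z2 - c1 * c2 + z1 * a2 = 0 := by
          rw [hc1, hc2]
          linear_combination (z1 * z2) * ha + a1 * a2 * hz
            + (-(a1 * z2 + z1 * a2)) * haz
        have k3 : a1 * z3 - c1 * c3 + z1 * a3 = 0 := by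
          rw [hc1, hc3]
          linear_combination (z1 * z3) * ha + a1 * a3 * hz
            + (-(a1 * z3 + z1 * a3)) * haz
        have k : (0:ℂ) • o + a1 • e1 + (-c1) • e2 + (0:ℂ) • e3 + z1 • P =
            (a1 * z1 - c1 * c1 + z1 * a1) • y1 + (a1 * z2 - c1 * c2 + z1 * a2) • y2
            + (a1 * z3 - c1 * c3 + z1 * a3) • y3 := by
          rw [he1, he2, hPd']; module
        rw [k, k1, k2, k3]; module
      · have k1 : a2 * z1 - c2 * c1 + z2 * a1 = 0 := by
          rw [hc2, hc1]
          linear_combination (z2 * z1) * ha + a2 * a1 * hz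
            + (-(a2 * z1 + z2 * a1)) * haz
        have k2 : a2 * z2 - c2 * c2 + z2 * a2 = 1 := by
          rw [hc2]
          linear_combination (z2 * z2 - (z1 ^ 2 + z2 ^ 2 + z3 ^ 2)) * ha + a2 * a2 * hz
            + (-(a2 * z2 + z2 * a2) + (a1 * z1 + a2 * z2 + a3 * z3 + 1)) * haz
        have k3 : a2 * z3 - c2 * c3 + z2 * a3 = 0 := by
          rw [hc2, hc3]
          linear_combination (z2 * z3) * ha + a2 * a3 * hz
            + (-(a2 * z3 + z2 * a3)) * haz
        have k : (0:ℂ) • o + a2 • e1 + (-c2) • e2 + (0:ℂ) • e3 + z2 • P =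
            (a2 * z1 - c2 * c1 + z2 * a1) • y1 + (a2 * z2 - c2 * c2 + z2 * a2) • y2
            + (a2 * z3 - c2 * c3 + z2 * a3) • y3 := by
          rw [he1, he2, hPd']; module
        rw [k, k1, k2, k3]; module
      · have k1 : a3 * z1 - c3 * c1 + z3 * a1 = 0 := by
          rw [hc3, hc1]
          linear_combination (z3 * z1) * ha + a3 * a1 * hz
            + (-(a3 * z1 + z3 * a1)) * haz
        have k2 : a3 * z2 - c3 * c2 + z3 * a2 = 0 := by
          rw [hc3, hc2]
          linear_combination (z3 * z2) * ha + a3 * a2 * hz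
            + (-(a3 * z2 + z3 * a2)) * haz
        have k3 : a3 * z3 - c3 * c3 + z3 * a3 = 1 := by
          rw [hc3]
          linear_combination (z3 * z3 - (z1 ^ 2 + z2 ^ 2 + z3 ^ 2)) * ha + a3 * a3 * hz
            + (-(a3 * z3 + z3 * a3) + (a1 * z1 + a2 * z2 + a3 * z3 + 1)) * haz
        have k : (0:ℂ) • o + a3 • e1 + (-c3) • e2 + (0:ℂ) • e3 + z3 • P =
            (a3 * z1 - c3 * c1 + z3 * a1) • y1 + (a3 * z2 - c3 * c2 + z3 * a2) • y2
            + (a3 * z3 - c3 * c3 + z3 * a3) • y3 := by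
          rw [he1, he2, hPd']; module
        rw [k, k1, k2, k3]; module
      · rw [he3]; module
    exact singPf hW T hT hs' ho hPP hP3 (det_I hT (ho _) (ho _) (ho _) (ho _) t11 t12 t13 t22 t23 t33)
  · have hs' : Sp o (y1 + Complex.I • y2) (Complex.I • y3) ((1 / 4 : ℂ) • y1 - (Complex.I / 4) • y2) P := by
      have J2 : y2 = (-(Complex.I * Complex.I)) • y2 := by rw [hI]; simp
      have J3 : y3 = (-(Complex.I * Complex.I)) • y3 := by rw [hI]; simp
      have c1 : Sp o (y1 + Complex.I • y2) (Complex.I • y3)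
          ((1 / 4 : ℂ) • y1 - (Complex.I / 4) • y2) y4 := by
        refine hs.chg _ _ _ _ _ ⟨1, 0, 0, 0, 0, by module⟩ ⟨0, 1 / 2, 0, 2, 0, by module⟩
          ⟨0, -Complex.I / 2, 0, 2 * Complex.I, 0, ?_⟩ ⟨0, 0, -Complex.I, 0, 0, ?_⟩
          ⟨0, 0, 0, 0, 1, by module⟩
        · nth_rewrite 1 [J2]; module
        · nth_rewrite 1 [J3]; module
      refine c1.chg _ _ _ _ _ ⟨1, 0, 0, 0, 0, by module⟩ ⟨0, 1, 0, 0, 0, by module⟩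
        ⟨0, 0, 1, 0, 0, by module⟩ ⟨0, 0, 0, 1, 0, by module⟩
        ⟨0, -a4⁻¹ * (a1 / 2 - a2 * Complex.I / 2), -a4⁻¹ * (-a3 * Complex.I), -a4⁻¹ * (2 * a1 + 2 * a2 * Complex.I), a4⁻¹, ?_⟩
      have J4 : y4 = (a4⁻¹ * a4) • y4 := by rw [inv_mul_cancel₀ h4]; simp
      have e1 : P = a1 • y1 + a2 • ((-(Complex.I * Complex.I)) • y2)
          + a3 • ((-(Complex.I * Complex.I)) • y3) + a4 • y4 := by
        rw [← J2, ← J3, hPd]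
      nth_rewrite 1 [J4]
      rw [e1]
      module
    refine singPf hW T hT hs' ho hPP hP3 (det_I hT (ho _) (ho _) (ho _) (ho _) ?_ ?_ ?_ ?_ ?_ ?_)
    all_goals
      simp [h12, h13, h14, h23, h24, h34, h11, h22, h33, h44, h21, h31, h41, h32, h42, h43]
    · linear_combination -(1/4) * hI
    · linear_combination (1/16) * hI

end CubicPf


set_option linter.unusedSimpArgs false

namespace CubicPf

variable {W : Type*} [AddCommGroup W] [Module ℂ W]

theorem rot {a b : ℂ} (h : a ≠ 0 ∨ b ≠ 0) : ∃ r s k l m n : ℂ, ∀ u v : W,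
    u = k • (r • u + s • v) + l • (b • u + a • v) ∧ v = m • (r • u + s • v) + n • (b • u + a • v) := by
  by_cases ha : a = 0
  · have hb : b ≠ 0 := by tauto
    refine ⟨0, 1, 0, b⁻¹, 1, 0, fun u v => ⟨?_, ?_⟩⟩
    · have : b⁻¹ • (b • u) = u := by rw [smul_smul, inv_mul_cancel₀ hb, one_smul]
      rw [ha]; simp [this]
    · simp
  · refine ⟨1, 0, 1, 0, -a⁻¹ * b, a⁻¹, fun u v => ⟨by module, ?_⟩⟩
    have : a⁻¹ • (a • v) = v := by rw [smul_smul, inv_mul_cancel₀ ha, one_smul]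
    nth_rewrite 1 [← this]; module

theorem sing2a [FiniteDimensional ℂ W] (hW : Module.finrank ℂ W = 5)
    (T : W →ₗ[ℂ] W →ₗ[ℂ] W →ₗ[ℂ] ℂ) (hT : SymT T) {o e1 e2 e3 e4 : W} (hs : Sp o e1 e2 e3 e4)
    (ho : ∀ v, T o o v = 0) (h11 : T o e1 e1 = 0) (h22 : T o e2 e2 = 0)
    (h13 : T o e1 e3 = 0) (h14 : T o e1 e4 = 0)
    (h23 : T o e2 e3 = 0) (h24 : T o e2 e4 = 0) (h33 : T o e3 e3 = 0) (h34 : T o e3 e4 = 0)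
    (h44 : T o e4 e4 = 0) (t333 : T e3 e3 e3 = 0) (t334 : T e3 e3 e4 = 0) (t344 : T e3 e4 e4 = 0)
    (t444 : T e4 e4 e4 = 0) (t144 : T e1 e4 e4 = 0) :
    IsPf (fun v => T v v v) := by
  obtain ⟨x, hx, -⟩ := hs.coord hW
  obtain ⟨c0, c1, d0, d1, p0, p1, p2⟩ := fac2 (T e2 e2 e2) (3 * T e2 e2 e4) (3 * T e2 e4 e4)
  refine crit2 _ (x 1) (x 2)
    ![T e1 e1 e1 • x 1 + (3 * T e1 e1 e3) • x 3 + (3 * T e1 e1 e4) • x 4,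
      (3 * T e1 e3 e3) • x 3 + (6 * T e1 e3 e4) • x 4, 0]
    ![(6 * T o e1 e2) • x 0 + (3 * T e1 e1 e2) • x 1 + (3 * T e1 e2 e2) • x 2
        + (6 * T e1 e2 e3) • x 3 + (6 * T e1 e2 e4) • x 4,
      (3 * T e2 e2 e3) • x 2 + (3 * T e2 e3 e3) • x 3 + (6 * T e2 e3 e4) • x 4,
      d0 • x 2 + d1 • x 4] ![x 1, x 3, c0 • x 2 + c1 • x 4] ?_
  intro v
  have key := exp5 hT o e1 e2 e3 e4 (x 0 v) (x 1 v) (x 2 v) (x 3 v) (x 4 v)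
  rw [← hx v] at key
  rw [key]
  simp [ho, h11, h22, h13, h14, h23, h24, h33, h34, h44, t333, t334, t344, t444, t144]
  linear_combination (x 2 v) ^ 3 * p0 + (x 2 v) ^ 2 * x 4 v * p1 + x 2 v * (x 4 v) ^ 2 * p2

theorem sing2b [FiniteDimensional ℂ W] (hW : Module.finrank ℂ W = 5)
    (T : W →ₗ[ℂ] W →ₗ[ℂ] W →ₗ[ℂ] ℂ) (hT : SymT T) {o e1 e2 e3 e4 : W} (hs : Sp o e1 e2 e3 e4)
    (ho : ∀ v, T o o v = 0) (h11 : T o e1 e1 = 0) (h22 : T o e2 e2 = 0)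
    (h13 : T o e1 e3 = 0) (h14 : T o e1 e4 = 0)
    (h23 : T o e2 e3 = 0) (h24 : T o e2 e4 = 0) (h33 : T o e3 e3 = 0) (h34 : T o e3 e4 = 0)
    (h44 : T o e4 e4 = 0) (t333 : T e3 e3 e3 = 0) (t334 : T e3 e3 e4 = 0) (t344 : T e3 e4 e4 = 0)
    (t444 : T e4 e4 e4 = 0) :
    IsPf (fun v => T v v v) := by
  obtain ⟨a, b, hab, hr⟩ := binroot2 (T e1 e3 e3) (2 * T e1 e3 e4) (T e1 e4 e4)
  obtain ⟨r, s, k, l, m, n, hrot⟩ := rot (W := W) hab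
  obtain ⟨hk, hm⟩ := hrot e3 e4
  have h43 := (hT.2 o e4 e3).trans h34
  have t343 := (hT.2 e3 e4 e3).trans t334
  have t433 := (hT.1 e4 e3 e3).trans t343
  have t434 := (hT.1 e4 e3 e4).trans t344
  have t443 := (hT.2 e4 e4 e3).trans t434
  refine sing2a hW T hT (o := o) (e1 := e1) (e2 := e2) (e3 := r • e3 + s • e4)
    (e4 := b • e3 + a • e4) (hs.chg _ _ _ _ _ ⟨1, 0, 0, 0, 0, by module⟩ ⟨0, 1, 0, 0, 0, by module⟩
    ⟨0, 0, 1, 0, 0, by module⟩ ⟨0, 0, 0, k, l, ?_⟩ ⟨0, 0, 0, m, n, ?_⟩) ho h11 h22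
    ?_ ?_ ?_ ?_ ?_ ?_ ?_ ?_ ?_ ?_ ?_ ?_
  · nth_rewrite 1 [hk]; module
  · nth_rewrite 1 [hm]; module
  all_goals
    simp [h13, h14, h23, h24, h33, h34, h44, h43, t333, t334, t344, t444, t343, t433, t434, t443]
  rw [hT.2 e1 e4 e3]; linear_combination hr

theorem sing2c [FiniteDimensional ℂ W] (hW : Module.finrank ℂ W = 5)
    (T : W →ₗ[ℂ] W →ₗ[ℂ] W →ₗ[ℂ] ℂ) (hT : SymT T) {o e1 e2 e3 e4 : W} (hs : Sp o e1 e2 e3 e4)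
    (ho : ∀ v, T o o v = 0) (h11 : T o e1 e1 = 0) (h22 : T o e2 e2 = 0)
    (h13 : T o e1 e3 = 0)
    (h23 : T o e2 e3 = 0) (h33 : T o e3 e3 = 0)
    (h44 : T o e4 e4 = 0) (t333 : T e3 e3 e3 ≠ 0) (t444 : T e4 e4 e4 = 0) :
    IsPf (fun v => T v v v) := by
  obtain ⟨a, b, hab, hr⟩ := binroot3 (T e3 e3 e3) (3 * T e2 e3 e3) (3 * T e2 e2 e3) (T e2 e2 e2)
  have ha : a ≠ 0 := by
    rintro rfl
    have hb : b ≠ 0 := by tauto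
    have : T e3 e3 e3 * b ^ 3 = 0 := by linear_combination hr
    simp [t333, hb] at this
  obtain ⟨z, hz⟩ : ∃ z, z = b / a := ⟨_, rfl⟩
  refine singPf hW T hT (o := o) (e1 := e1) (e2 := e2 + z • e3) (e3 := e3) (w := e4)
    (hs.chg _ _ _ _ _ ⟨1, 0, 0, 0, 0, by module⟩ ⟨0, 1, 0, 0, 0, by module⟩
    ⟨0, 0, 1, -z, 0, by module⟩ ⟨0, 0, 0, 1, 0, by module⟩ ⟨0, 0, 0, 0, 1, by module⟩) ho h44 t444
    (det_II hT (ho _) (ho _) (ho _) (ho _) h11 h13 ?_ ?_ h33 ?_)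
  · simp [h22, h23, h33, (hT.2 o e3 e2).trans h23]
  · simp [h23, h33]
  · have := exp2 hT e2 e3 1 z
    rw [one_smul] at this
    rw [this, hz]
    field_simp
    linear_combination hr

theorem sing2d [FiniteDimensional ℂ W] (hW : Module.finrank ℂ W = 5)
    (T : W →ₗ[ℂ] W →ₗ[ℂ] W →ₗ[ℂ] ℂ) (hT : SymT T) {o e1 e2 e3 e4 : W} (hs : Sp o e1 e2 e3 e4)
    (ho : ∀ v, T o o v = 0) (h11 : T o e1 e1 = 0) (h22 : T o e2 e2 = 0)
    (h13 : T o e1 e3 = 0) (h14 : T o e1 e4 = 0)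
    (h23 : T o e2 e3 = 0) (h24 : T o e2 e4 = 0) (h33 : T o e3 e3 = 0) (h34 : T o e3 e4 = 0)
    (h44 : T o e4 e4 = 0) (t444 : T e4 e4 e4 = 0) :
    IsPf (fun v => T v v v) := by
  have h43 := (hT.2 o e4 e3).trans h34
  by_cases t333 : T e3 e3 e3 = 0
  swap
  · exact sing2c hW T hT hs ho h11 h22 h13 h23 h33 h44 t333 t444
  have hc : ∀ c : ℂ, T (e3 + c • e4) (e3 + c • e4) (e3 + c • e4) ≠ 0 → IsPf (fun v => T v v v) := by
    intro c hc
    refine sing2c hW T hT (o := o) (e1 := e1) (e2 := e2) (e3 := e3 + c • e4) (e4 := e4)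
      (hs.chg _ _ _ _ _ ⟨1, 0, 0, 0, 0, by module⟩ ⟨0, 1, 0, 0, 0, by module⟩
      ⟨0, 0, 1, 0, 0, by module⟩ ⟨0, 0, 0, 1, -c, by module⟩ ⟨0, 0, 0, 0, 1, by module⟩)
      ho h11 h22 ?_ ?_ ?_ h44 hc t444 <;> simp [h13, h14, h23, h24, h33, h34, h43, h44]
  have ec : ∀ c : ℂ, T (e3 + c • e4) (e3 + c • e4) (e3 + c • e4)
      = 3 * c * T e3 e3 e4 + 3 * c ^ 2 * T e3 e4 e4 := by
    intro c
    have := exp2 hT e3 e4 1 c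
    rw [one_smul] at this
    rw [this, t333, t444]; ring
  by_cases q1 : T (e3 + (1:ℂ) • e4) (e3 + (1:ℂ) • e4) (e3 + (1:ℂ) • e4) = 0
  swap
  · exact hc _ q1
  by_cases q2 : T (e3 + (-1:ℂ) • e4) (e3 + (-1:ℂ) • e4) (e3 + (-1:ℂ) • e4) = 0
  swap
  · exact hc _ q2
  rw [ec] at q1 q2
  exact sing2b hW T hT hs ho h11 h22 h13 h14 h23 h24 h33 h34 h44 t333
    (by linear_combination (q1 - q2) / 6) (by linear_combination (q1 + q2) / 6) t444

theorem sing2 [FiniteDimensional ℂ W] (hW : Module.finrank ℂ W = 5)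
    (T : W →ₗ[ℂ] W →ₗ[ℂ] W →ₗ[ℂ] ℂ) (hT : SymT T) {o y1 y2 e3 e4 : W} (hs : Sp o y1 y2 e3 e4)
    (ho : ∀ v, T o o v = 0) (h11 : T o y1 y1 = 1) (h22 : T o y2 y2 = 1) (h12 : T o y1 y2 = 0)
    (h13 : T o y1 e3 = 0) (h14 : T o y1 e4 = 0)
    (h23 : T o y2 e3 = 0) (h24 : T o y2 e4 = 0) (h33 : T o e3 e3 = 0) (h34 : T o e3 e4 = 0)
    (h44 : T o e4 e4 = 0) :
    IsPf (fun v => T v v v) := by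
  have hI : Complex.I * Complex.I = -1 := Complex.I_mul_I
  have h43 := (hT.2 o e4 e3).trans h34
  have h21 := (hT.2 o y2 y1).trans h12
  obtain ⟨a, b, hab, hr⟩ := binroot3 (T e3 e3 e3) (3 * T e3 e3 e4) (3 * T e3 e4 e4) (T e4 e4 e4)
  obtain ⟨r, s, k, l, m, n, hrot⟩ := rot (W := W) hab
  obtain ⟨hk, hm⟩ := hrot e3 e4
  have J2 : y2 = (-(Complex.I * Complex.I)) • y2 := by rw [hI]; simp
  refine sing2d hW T hT (o := o) (e1 := y1 + Complex.I • y2) (e2 := y1 - Complex.I • y2)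
    (e3 := r • e3 + s • e4)
    (e4 := b • e3 + a • e4) (hs.chg _ _ _ _ _ ⟨1, 0, 0, 0, 0, by module⟩
    ⟨0, 1 / 2, 1 / 2, 0, 0, by module⟩
    ⟨0, -Complex.I / 2, Complex.I / 2, 0, 0, ?_⟩ ⟨0, 0, 0, k, l, ?_⟩ ⟨0, 0, 0, m, n, ?_⟩) ho
    ?_ ?_ ?_ ?_ ?_ ?_ ?_ ?_ ?_ ?_
  · nth_rewrite 1 [J2]; module
  · nth_rewrite 1 [hk]; module
  · nth_rewrite 1 [hm]; module
  on_goal 10 => rw [exp2 hT]; linear_combination hr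
  all_goals
    simp [h11, h12, h21, h22, h13, h14, h23, h24, h33, h34, h44, h43]

end CubicPf


set_option linter.unusedSimpArgs false

namespace CubicPf

variable {W : Type*} [AddCommGroup W] [Module ℂ W]

theorem sing1c [FiniteDimensional ℂ W] (hW : Module.finrank ℂ W = 5)
    (T : W →ₗ[ℂ] W →ₗ[ℂ] W →ₗ[ℂ] ℂ) (hT : SymT T) {o e1 e2 e3 e4 : W} (hs : Sp o e1 e2 e3 e4)
    (ho : ∀ v, T o o v = 0) (h2 : ∀ v, T o e2 v = 0) (h3 : ∀ v, T o e3 v = 0)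
    (h4 : ∀ v, T o e4 v = 0) (t223 : T e2 e2 e3 = 0) (t224 : T e2 e2 e4 = 0)
    (t233 : T e2 e3 e3 = 0) (t234 : T e2 e3 e4 = 0) (t244 : T e2 e4 e4 = 0)
    (t333 : T e3 e3 e3 = 0) (t334 : T e3 e3 e4 = 0) (t344 : T e3 e4 e4 = 0)
    (t444 : T e4 e4 e4 = 0) :
    IsPf (fun v => T v v v) := by
  obtain ⟨x, hx, -⟩ := hs.coord hW
  obtain ⟨c0, c1, d0, d1, p0, p1, p2⟩ := fac2 (3 * T e1 e3 e3) (6 * T e1 e3 e4) (3 * T e1 e4 e4)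
  refine crit2 _ (x 1) (x 2)
    ![(3 * T o e1 e1) • x 0 + T e1 e1 e1 • x 1 + (3 * T e1 e1 e2) • x 2 + (3 * T e1 e1 e3) • x 3
        + (3 * T e1 e1 e4) • x 4,
      (3 * T e1 e2 e2) • x 2 + (6 * T e1 e2 e3) • x 3 + (6 * T e1 e2 e4) • x 4,
      d0 • x 3 + d1 • x 4]
    ![0, T e2 e2 e2 • x 2, 0] ![x 1, x 2, c0 • x 3 + c1 • x 4] ?_
  intro v
  have key := exp5 hT o e1 e2 e3 e4 (x 0 v) (x 1 v) (x 2 v) (x 3 v) (x 4 v)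
  rw [← hx v] at key
  rw [key, hT.2 o e1 e2, hT.2 o e1 e3, hT.2 o e1 e4]
  simp [ho, h2, h3, h4, t223, t224, t233, t234, t244, t333, t334, t344, t444]
  linear_combination x 1 v * (x 3 v) ^ 2 * p0 + x 1 v * x 3 v * x 4 v * p1
    + x 1 v * (x 4 v) ^ 2 * p2

theorem simpleroot {α β γ : ℂ} (hα : α ≠ 0) (h : β ≠ 0 ∨ γ ≠ 0) : ∃ r r' : ℂ,
    α * r ^ 3 + 3 * β * r + γ = 0 ∧ α * r' ^ 3 + 3 * β * r' + γ = 0 ∧ r ≠ r' ∧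
      α * r ^ 2 + β ≠ 0 := by
  obtain ⟨a, b, hab, hr⟩ := binroot3 α 0 (3 * β) γ
  have ha : a ≠ 0 := by
    rintro rfl
    have hb : b ≠ 0 := by tauto
    have : α * b ^ 3 = 0 := by linear_combination hr
    simp [hα, hb] at this
  obtain ⟨s, hs⟩ : ∃ s, s = b / a := ⟨_, rfl⟩
  have es : α * s ^ 3 + 3 * β * s + γ = 0 := by
    rw [hs]; field_simp; linear_combination hr
  obtain ⟨d, hd⟩ := IsAlgClosed.exists_pow_nat_eq (s ^ 2 - 4 * (s ^ 2 + 3 * β / α)) (n := 2) (by norm_num)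
  obtain ⟨t, ht⟩ : ∃ t, t = (-s + d) / 2 := ⟨_, rfl⟩
  have et : α * (t ^ 2 + s * t + s ^ 2) + 3 * β = 0 := by
    have : α * (3 * β / α) = 3 * β := by field_simp
    rw [ht]; linear_combination α / 4 * hd - this
  have eβ : β = -α * (t ^ 2 + s * t + s ^ 2) / 3 := by linear_combination et / 3
  have eγ : γ = α * s * t * (s + t) := by rw [eβ] at es; linear_combination es
  have hne : s ≠ 0 ∨ t ≠ 0 := by
    by_contra hcon
    push Not at hcon
    rw [eβ, eγ, hcon.1, hcon.2] at h
    simp at h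
  by_cases c1 : s = t
  · have hs0 : s ≠ 0 := by
      rw [c1] at hne ⊢; tauto
    refine ⟨-2 * s, s, ?_, es, ?_, ?_⟩
    · rw [eβ, eγ, ← c1]; ring
    · intro h; apply hs0; linear_combination (-1/3) * h
    · rw [eβ, ← c1, show α * (-2 * s) ^ 2 + -α * (s ^ 2 + s * s + s ^ 2) / 3 = 3 * (α * s ^ 2) by ring]
      simp [hα, hs0]
  by_cases c2 : t = -2 * s
  · have hs0 : s ≠ 0 := by
      rintro rfl
      simp at c2; simp [c2] at hne
    refine ⟨t, s, ?_, es, fun h => c1 h.symm, ?_⟩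
    · rw [eβ, eγ, c2]; ring
    · rw [eβ, c2, show α * (-2 * s) ^ 2 + -α * ((-2 * s) ^ 2 + s * (-2 * s) + s ^ 2) / 3
        = 3 * (α * s ^ 2) by ring]
      simp [hα, hs0]
  · refine ⟨s, t, es, ?_, c1, ?_⟩
    · rw [eβ, eγ]; ring
    · rw [eβ, show α * s ^ 2 + -α * (t ^ 2 + s * t + s ^ 2) / 3 = -α * (t - s) * (t - (-2 * s)) / 3
        by ring]
      have h2 := sub_ne_zero.mpr c2
      have := sub_ne_zero.mpr (Ne.symm c1)
      exact div_ne_zero (mul_ne_zero (mul_ne_zero (neg_ne_zero.mpr hα) this) h2) (by norm_num)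

theorem sing1d [FiniteDimensional ℂ W] (hW : Module.finrank ℂ W = 5)
    (T : W →ₗ[ℂ] W →ₗ[ℂ] W →ₗ[ℂ] ℂ) (hT : SymT T) {o e1 e2 e3 e4 : W} (hs : Sp o e1 e2 e3 e4)
    (ho : ∀ v, T o o v = 0) (h2 : ∀ v, T o e2 v = 0) (h3 : ∀ v, T o e3 v = 0)
    (h4 : ∀ v, T o e4 v = 0) (t222 : T e2 e2 e2 = 0) (t223 : T e2 e2 e3 ≠ 0)
    (t333 : T e3 e3 e3 = 0) (t444 : T e4 e4 e4 = 0) :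
    IsPf (fun v => T v v v) := by
  obtain ⟨z, hz⟩ : ∃ z, z = - T e1 e2 e2 / T e2 e2 e3 := ⟨_, rfl⟩
  refine singPf hW T hT (o := o) (e1 := e1 + z • e3) (e2 := e2) (e3 := e3) (w := e4)
    (hs.chg _ _ _ _ _ ⟨1, 0, 0, 0, 0, by module⟩ ⟨0, 1, 0, -z, 0, by module⟩
    ⟨0, 0, 1, 0, 0, by module⟩ ⟨0, 0, 0, 1, 0, by module⟩ ⟨0, 0, 0, 0, 1, by module⟩) ho (h4 _) t444
    (det_III hT (ho _) (ho _) (ho _) (ho _) ?_ ?_ (h2 _) (h2 _) (h3 _) t222 ?_ t333)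
  · rw [hT.2, h2]
  · rw [hT.2, h3]
  · have : T e3 e2 e2 = T e2 e2 e3 := by rw [hT.1, hT.2]
    simp [this, hz]
    field_simp
    simp

theorem sing1e [FiniteDimensional ℂ W] (hW : Module.finrank ℂ W = 5)
    (T : W →ₗ[ℂ] W →ₗ[ℂ] W →ₗ[ℂ] ℂ) (hT : SymT T) {o e1 A B C : W} (hs : Sp o e1 A B C)
    (ho : ∀ v, T o o v = 0) (h2 : ∀ v, T o A v = 0) (h3 : ∀ v, T o B v = 0)
    (h4 : ∀ v, T o C v = 0) (tA : T A A A ≠ 0) (tAB : T A A B = 0)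
    (hb : T A B B ≠ 0 ∨ T B B B ≠ 0) :
    IsPf (fun v => T v v v) := by
  obtain ⟨r, r', e, e', hrr, hd⟩ := simpleroot tA hb
  obtain ⟨a, b, hab, hr⟩ := binroot3 (T A A A) (3 * T A A C) (3 * T A C C) (T C C C)
  have ha : a ≠ 0 := by
    rintro rfl
    have hb : b ≠ 0 := by tauto
    have : T A A A * b ^ 3 = 0 := by linear_combination hr
    simp [tA, hb] at this
  obtain ⟨t, ht⟩ : ∃ t, t = b / a := ⟨_, rfl⟩
  have hn := sub_ne_zero.mpr hrr
  obtain ⟨k, hk⟩ : ∃ k, k = (r - r')⁻¹ := ⟨_, rfl⟩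
  have hk1 : k * (r - r') = 1 := by rw [hk]; field_simp
  have JA : A = (k * (r - r')) • A := by rw [hk1, one_smul]
  have cub : ∀ x : ℂ, T (x • A + B) (x • A + B) (x • A + B) =
      T A A A * x ^ 3 + 3 * T A B B * x + T B B B := by
    intro x
    have := exp2 hT A B x 1
    rw [one_smul] at this
    rw [this, tAB]; ring
  refine sing1d hW T hT (o := o) (e1 := e1) (e2 := r • A + B) (e3 := r' • A + B) (e4 := t • A + C)
    (hs.chg _ _ _ _ _ ⟨1, 0, 0, 0, 0, by module⟩ ⟨0, 1, 0, 0, 0, by module⟩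
    ⟨0, 0, k, -k, 0, ?_⟩ ⟨0, 0, 1 - r * k, r * k, 0, ?_⟩ ⟨0, 0, - t * k, t * k, 1, ?_⟩) ho
    (by simp [h2, h3]) (by simp [h2, h3]) (by simp [h2, h4]) ?_ ?_ ?_ ?_
  · nth_rewrite 1 [JA]; module
  · have : r • A = r • ((k * (r - r')) • A) := by rw [← JA]
    rw [show (0:ℂ) • o + (0:ℂ) • e1 + (1 - r * k) • (r • A + B) + (r * k) • (r' • A + B)
      + (0:ℂ) • (t • A + C) = B + (r • A - r • ((k * (r - r')) • A)) by module, ← this]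
    simp
  · have : t • A = t • ((k * (r - r')) • A) := by rw [← JA]
    rw [show (0:ℂ) • o + (0:ℂ) • e1 + (- t * k) • (r • A + B) + (t * k) • (r' • A + B)
      + (1:ℂ) • (t • A + C) = C + (t • A - t • ((k * (r - r')) • A)) by module, ← this]
    simp
  · rw [cub]; exact e
  · have q := qexp2 hT A B (r' • A + B) r 1
    rw [one_smul] at q
    rw [q]
    simp only [map_add, map_smul, smul_eq_mul, tAB, hT.2 A B A, hT.2 B B A, hT.1 B A B]
    have : (r' - r) * (T A A A * r ^ 2 + T A B B) ≠ 0 := mul_ne_zero (sub_ne_zero.mpr (Ne.symm hrr)) hd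
    intro h0
    apply this
    linear_combination h0 - e
  · rw [cub]; exact e'
  · have := exp2 hT A C t 1
    rw [one_smul] at this
    rw [this, ht]
    field_simp
    linear_combination hr

theorem sing1f [FiniteDimensional ℂ W] (hW : Module.finrank ℂ W = 5)
    (T : W →ₗ[ℂ] W →ₗ[ℂ] W →ₗ[ℂ] ℂ) (hT : SymT T) {o e1 A B C : W} (hs : Sp o e1 A B C)
    (ho : ∀ v, T o o v = 0) (h2 : ∀ v, T o A v = 0) (h3 : ∀ v, T o B v = 0)
    (h4 : ∀ v, T o C v = 0) (tA : T A A A ≠ 0) (tAB : T A A B = 0) (tAC : T A A C = 0) :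
    IsPf (fun v => T v v v) := by
  by_cases c1 : T A B B ≠ 0 ∨ T B B B ≠ 0
  · exact sing1e hW T hT hs ho h2 h3 h4 tA tAB c1
  by_cases c2 : T A C C ≠ 0 ∨ T C C C ≠ 0
  · exact sing1e hW T hT (o := o) (e1 := e1) (A := A) (B := C) (C := B) (hs.chg _ _ _ _ _ ⟨1, 0, 0, 0, 0, by module⟩ ⟨0, 1, 0, 0, 0, by module⟩
      ⟨0, 0, 1, 0, 0, by module⟩ ⟨0, 0, 0, 0, 1, by module⟩ ⟨0, 0, 0, 1, 0, by module⟩)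
      ho h2 h4 h3 tA tAC c2
  push Not at c1 c2
  have hc : ∀ c : ℂ, (2 * c * T A B C ≠ 0 ∨ 3 * c * T B B C + 3 * c ^ 2 * T B C C ≠ 0) →
      IsPf (fun v => T v v v) := by
    intro c hc
    refine sing1e hW T hT (o := o) (e1 := e1) (A := A) (B := B + c • C) (C := C)
      (hs.chg _ _ _ _ _ ⟨1, 0, 0, 0, 0, by module⟩ ⟨0, 1, 0, 0, 0, by module⟩
      ⟨0, 0, 1, 0, 0, by module⟩ ⟨0, 0, 0, 1, -c, by module⟩ ⟨0, 0, 0, 0, 1, by module⟩)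
      ho h2 (by simp [h3, h4]) h4 tA (by simp [tAB, tAC]) ?_
    have E1 : T A (B + c • C) (B + c • C) = 2 * c * T A B C := by
      simp [c1.1, c2.1, hT.2 A C B]; ring
    have E2 : T (B + c • C) (B + c • C) (B + c • C) = 3 * c * T B B C + 3 * c ^ 2 * T B C C := by
      have := exp2 hT B C 1 c
      rw [one_smul] at this
      rw [this, c1.2, c2.2]; ring
    rw [E1, E2]; exact hc
  by_cases p1 : 2 * (1:ℂ) * T A B C ≠ 0 ∨ 3 * (1:ℂ) * T B B C + 3 * (1:ℂ) ^ 2 * T B C C ≠ 0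
  · exact hc _ p1
  by_cases p2 : 2 * (-1:ℂ) * T A B C ≠ 0 ∨ 3 * (-1:ℂ) * T B B C + 3 * (-1:ℂ) ^ 2 * T B C C ≠ 0
  · exact hc _ p2
  push Not at p1 p2
  exact sing1c hW T hT hs ho h2 h3 h4 tAB tAC c1.1 (by linear_combination p1.1 / 2) c2.1 c1.2
    (by linear_combination (p1.2 - p2.2) / 6) (by linear_combination (p1.2 + p2.2) / 6) c2.2

theorem sing1 [FiniteDimensional ℂ W] (hW : Module.finrank ℂ W = 5)
    (T : W →ₗ[ℂ] W →ₗ[ℂ] W →ₗ[ℂ] ℂ) (hT : SymT T) {o e1 e2 e3 e4 : W} (hs : Sp o e1 e2 e3 e4)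
    (ho : ∀ v, T o o v = 0) (h2 : ∀ v, T o e2 v = 0) (h3 : ∀ v, T o e3 v = 0)
    (h4 : ∀ v, T o e4 v = 0) :
    IsPf (fun v => T v v v) := by
  have g : ∀ {A B C : W}, Sp o e1 A B C → (∀ v, T o A v = 0) → (∀ v, T o B v = 0) →
      (∀ v, T o C v = 0) → T A A A ≠ 0 → IsPf (fun v => T v v v) := by
    intro A B C hs hA hB hC hn
    obtain ⟨b, hb⟩ : ∃ b, b = - T A A B / T A A A := ⟨_, rfl⟩
    obtain ⟨c, hc⟩ : ∃ c, c = - T A A C / T A A A := ⟨_, rfl⟩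
    refine sing1f hW T hT (o := o) (e1 := e1) (A := A) (B := B + b • A) (C := C + c • A)
      (hs.chg _ _ _ _ _ ⟨1, 0, 0, 0, 0, by module⟩ ⟨0, 1, 0, 0, 0, by module⟩
      ⟨0, 0, 1, 0, 0, by module⟩ ⟨0, 0, -b, 1, 0, by module⟩ ⟨0, 0, -c, 0, 1, by module⟩)
      ho hA (by simp [hA, hB]) (by simp [hA, hC]) hn ?_ ?_
    · simp [hb]; field_simp; simp
    · simp [hc]; field_simp; simp
  by_cases q3 : T e3 e3 e3 = 0
  swap
  · exact g (hs.chg _ _ _ _ _ ⟨1, 0, 0, 0, 0, by module⟩ ⟨0, 1, 0, 0, 0, by module⟩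
      ⟨0, 0, 0, 1, 0, by module⟩ ⟨0, 0, 1, 0, 0, by module⟩ ⟨0, 0, 0, 0, 1, by module⟩)
      h3 h2 h4 q3
  by_cases q4 : T e4 e4 e4 = 0
  swap
  · exact g (hs.chg _ _ _ _ _ ⟨1, 0, 0, 0, 0, by module⟩ ⟨0, 1, 0, 0, 0, by module⟩
      ⟨0, 0, 0, 1, 0, by module⟩ ⟨0, 0, 0, 0, 1, by module⟩ ⟨0, 0, 1, 0, 0, by module⟩)
      h4 h2 h3 q4
  by_cases q : ∃ p q : ℂ, T ((1:ℂ) • e2 + p • e3 + q • e4) ((1:ℂ) • e2 + p • e3 + q • e4)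
    ((1:ℂ) • e2 + p • e3 + q • e4) ≠ 0
  · obtain ⟨p, q, hpq⟩ := q
    exact g (hs.chg _ _ _ _ _ ⟨1, 0, 0, 0, 0, by module⟩ ⟨0, 1, 0, 0, 0, by module⟩
      ⟨0, 0, 1, -p, -q, by module⟩ ⟨0, 0, 0, 1, 0, by module⟩ ⟨0, 0, 0, 0, 1, by module⟩)
      (by simp [h2, h3, h4]) h3 h4 hpq
  push Not at q
  simp only [exp3 hT, q3, q4] at q
  have z := q 0 0
  have a1 := q 1 0
  have a2 := q (-1) 0
  have a3 := q 2 0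
  have b1 := q 0 1
  have b2 := q 0 (-1)
  have b3 := q 0 2
  have c1 := q 1 1
  have c2 := q 1 (-1)
  have c3 := q (-1) 1
  have E0 : T e2 e2 e2 = 0 := by linear_combination z
  have E1 : T e2 e2 e3 = 0 := by linear_combination (a1 - a2) / 6
  have E2 : T e2 e2 e4 = 0 := by linear_combination (b1 - b2) / 6
  have E3 : T e2 e3 e3 = 0 := by linear_combination (a1 + a2) / 6 - E0 / 3
  have E4 : T e2 e4 e4 = 0 := by linear_combination (b1 + b2) / 6 - E0 / 3
  simp only [E0, E1, E2, E3, E4] at c1 c2 c3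
  exact sing1c hW T hT hs ho h2 h3 h4 E1 E2 E3
    (by linear_combination (-c2 - c3) / 12) E4 q3
    (by linear_combination (c1 + c3) / 6) (by linear_combination (c1 + c2) / 6) q4

end CubicPf


set_option linter.unusedSimpArgs false

namespace CubicPf

variable {W : Type*} [AddCommGroup W] [Module ℂ W]

/-- the singular case -/
theorem singAll [FiniteDimensional ℂ W] (hW : Module.finrank ℂ W = 5)
    (T : W →ₗ[ℂ] W →ₗ[ℂ] W →ₗ[ℂ] ℂ) (hT : SymT T) {o : W} (ho0 : o ≠ 0)
    (ho : ∀ v, T o o v = 0) : IsPf (fun v => T v v v) := by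
  obtain ⟨U, -, hU1, hU2, hU3⟩ := compl_in o ho0 ⊤ (by trivial)
  have hU4 : Module.finrank ℂ U = 4 := by
    rw [finrank_top, hW] at hU3; omega
  obtain ⟨y, -, hyU, hys, hyo, hyd, hym⟩ := diag U hU4 (T o) (hT.2 o)
  have hs : Sp o (y 0) (y 1) (y 2) (y 3) := by
    intro v
    obtain ⟨c, u, hu, rfl⟩ := hU2 v trivial
    obtain ⟨d, rfl⟩ := hys u hu
    refine ⟨c, d 0, d 1, d 2, d 3, ?_⟩
    rw [Fin.sum_univ_four]; module
  rcases hyd 2 with d2 | d2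
  · have d3 : T o (y 3) (y 3) = 0 := by
      rcases hyd 3 with d | d
      · exact d
      · exfalso
        have := hym 2 3 (by decide) d
        rw [d2] at this; simp at this
    rcases hyd 1 with d1 | d1
    · have all : ∀ i : Fin 4, i ≠ 0 → T o (y i) (y i) = 0 → ∀ v, T o (y i) v = 0 := by
        intro i hi hii v
        have hij : ∀ j, T o (y i) (y j) = 0 := by
          intro j
          by_cases h : i = j
          · rw [← h, hii]
          · exact hyo i j h
        obtain ⟨x0, x1, x2, x3, x4, rfl⟩ := hs v
        simp [hij, hT.2 o (y i) o, ho]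
      exact sing1 hW T hT hs ho (all 1 (by decide) d1) (all 2 (by decide) d2) (all 3 (by decide) d3)
    · have d0 := hym 0 1 (by decide) d1
      exact sing2 hW T hT hs ho d0 d1 (hyo 0 1 (by decide)) (hyo 0 2 (by decide)) (hyo 0 3 (by decide))
        (hyo 1 2 (by decide)) (hyo 1 3 (by decide)) d2 (hyo 2 3 (by decide)) d3
  · have d0 := hym 0 2 (by decide) d2
    have d1 := hym 1 2 (by decide) d2
    exact sing3 hW T hT hs ho0 ho (hyo 0 1 (by decide)) (hyo 0 2 (by decide)) (hyo 0 3 (by decide))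
        (hyo 1 2 (by decide)) (hyo 1 3 (by decide)) (hyo 2 3 (by decide)) d0 d1 d2

end CubicPf


set_option linter.unusedSimpArgs false

namespace CubicPf

variable {W : Type*} [AddCommGroup W] [Module ℂ W]

theorem van6 {c0 c1 c2 c3 c4 c5 c6 : ℂ}
    (h : ∀ z : ℂ, c0 + c1 * z + c2 * z ^ 2 + c3 * z ^ 3 + c4 * z ^ 4 + c5 * z ^ 5 + c6 * z ^ 6 = 0) :
    c0 = 0 ∧ c1 = 0 ∧ c2 = 0 ∧ c3 = 0 ∧ c4 = 0 ∧ c5 = 0 ∧ c6 = 0 := by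
  have e0 := h 0
  have p1 := h 1
  have m1 := h (-1)
  have p2 := h 2
  have m2 := h (-2)
  have p3 := h 3
  have m3 := h (-3)
  have k0 : c0 = 0 := by linear_combination e0
  have E1 : c2 + c4 + c6 = 0 := by linear_combination (p1 + m1) / 2 - k0
  have E2 : c2 + 4 * c4 + 16 * c6 = 0 := by linear_combination (p2 + m2) / 8 - k0 / 4
  have E3 : c2 + 9 * c4 + 81 * c6 = 0 := by linear_combination (p3 + m3) / 18 - k0 / 9
  have O1 : c1 + c3 + c5 = 0 := by linear_combination (p1 - m1) / 2
  have O2 : c1 + 4 * c3 + 16 * c5 = 0 := by linear_combination (p2 - m2) / 4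
  have O3 : c1 + 9 * c3 + 81 * c5 = 0 := by linear_combination (p3 - m3) / 6
  have k6 : c6 = 0 := by linear_combination (E3 - E1 - (8 / 3) * (E2 - E1)) / 40
  have k5 : c5 = 0 := by linear_combination (O3 - O1 - (8 / 3) * (O2 - O1)) / 40
  have k4 : c4 = 0 := by linear_combination (E2 - E1 - 15 * k6) / 3
  have k3 : c3 = 0 := by linear_combination (O2 - O1 - 15 * k5) / 3
  exact ⟨k0, by linear_combination O1 - k3 - k5, by linear_combination E1 - k4 - k6, k3, k4, k5, k6⟩

theorem noSing {T : W →ₗ[ℂ] W →ₗ[ℂ] W →ₗ[ℂ] ℂ} (hT : SymT T) {o e1 e2 e3 e4 : W}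
    (hs : Sp o e1 e2 e3 e4) (hns : ∀ o, o ≠ 0 → ∃ v, T o o v ≠ 0) (V : ℂ → ℂ → W) (u0 u1 u2 : W)
    (hV : ∀ a b, V a b = (a ^ 2) • u0 + (a * b) • u1 + (b ^ 2) • u2)
    (hne : ∀ a b, a ≠ 0 ∨ b ≠ 0 → V a b ≠ 0)
    (h0 : ∀ a b, T (V a b) (V a b) o = 0) (h1 : ∀ a b, T (V a b) (V a b) e1 = 0)
    (h2 : ∀ a b, T (V a b) (V a b) e2 = 0) (h3 : ∀ a b, T (V a b) (V a b) e3 = 0) : False := by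
  obtain ⟨a, b, hab, hr⟩ := binroot4 (T u2 u2 e4) (2 * T u1 u2 e4) (2 * T u0 u2 e4 + T u1 u1 e4)
    (2 * T u0 u1 e4) (T u0 u0 e4)
  have h4 : T (V a b) (V a b) e4 = 0 := by
    rw [hV, qexp3 hT]; linear_combination hr
  obtain ⟨v, hv⟩ := hns _ (hne a b hab)
  apply hv
  obtain ⟨x0, x1, x2, x3, x4, rfl⟩ := hs v
  simp [h0, h1, h2, h3, h4]

theorem Sp.indep [FiniteDimensional ℂ W] (hW : Module.finrank ℂ W = 5) {e0 e1 e2 e3 e4 : W}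
    (h : Sp e0 e1 e2 e3 e4) {x0 x1 x2 x3 : ℂ} (hx : x0 • e0 + x1 • e1 + x2 • e2 + x3 • e3 = 0) :
    x0 = 0 ∧ x1 = 0 ∧ x2 = 0 ∧ x3 = 0 := by
  obtain ⟨x, -, hx'⟩ := h.coord hW
  have hx4 : x0 • e0 + x1 • e1 + x2 • e2 + x3 • e3 + (0:ℂ) • e4 = 0 := by rw [hx]; simp
  have k := fun i => hx' i x0 x1 x2 x3 0
  rw [hx4] at k
  simp only [map_zero] at k
  exact ⟨(k 0).symm, (k 1).symm, (k 2).symm, (k 3).symm⟩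

open Polynomial in
theorem sm3a [FiniteDimensional ℂ W] (hW : Module.finrank ℂ W = 5)
    (T : W →ₗ[ℂ] W →ₗ[ℂ] W →ₗ[ℂ] ℂ) (hT : SymT T) {o e1 e2 e3 e4 : W} (hs : Sp o e1 e2 e3 e4)
    (h0 : T o o o = 0) (h1 : T o o e1 = 0) (h2 : T o o e2 = 0) (h3 : T o o e3 = 0)
    (h11 : T o e1 e1 = 0) (h12 : T o e1 e2 = 0) (h13 : T o e1 e3 = 1 / 2) (h22 : T o e2 e2 = -1)
    (h23 : T o e2 e3 = 0) (h33 : T o e3 e3 = 0) (t333 : T e3 e3 e3 ≠ 0) :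
    IsPf (fun v => T v v v) := by
  have hG : ∀ x0 x1 x2 x3, G4 T o e1 e2 e3 x0 x1 x2 x3 = 3 * x0 * (x1 * x3 - x2 ^ 2)
      + (T e1 e1 e1 * x1 ^ 3 + 3 * T e1 e1 e2 * x1 ^ 2 * x2 + 3 * T e1 e1 e3 * x1 ^ 2 * x3
        + 3 * T e1 e2 e2 * x1 * x2 ^ 2 + 6 * T e1 e2 e3 * x1 * x2 * x3 + 3 * T e1 e3 e3 * x1 * x3 ^ 2
        + T e2 e2 e2 * x2 ^ 3 + 3 * T e2 e2 e3 * x2 ^ 2 * x3 + 3 * T e2 e3 e3 * x2 * x3 ^ 2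
        + T e3 e3 e3 * x3 ^ 3) := by
    intro x0 x1 x2 x3
    rw [G4, exp4 hT, h0, h1, h2, h3, h11, h12, h13, h22, h23, h33]; ring
  let P : ℂ[X] := C (T e1 e1 e1) + C (3 * T e1 e1 e2) * X + C (3 * T e1 e1 e3 + 3 * T e1 e2 e2) * X ^ 2
    + C (6 * T e1 e2 e3 + T e2 e2 e2) * X ^ 3 + C (3 * T e1 e3 e3 + 3 * T e2 e2 e3) * X ^ 4
    + C (3 * T e2 e3 e3) * X ^ 5 + C (T e3 e3 e3) * X ^ 6
  have hPe : ∀ z, P.eval z = T e1 e1 e1 + 3 * T e1 e1 e2 * z + (3 * T e1 e1 e3 + 3 * T e1 e2 e2) * z ^ 2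
    + (6 * T e1 e2 e3 + T e2 e2 e2) * z ^ 3 + (3 * T e1 e3 e3 + 3 * T e2 e2 e3) * z ^ 4
    + (3 * T e2 e3 e3) * z ^ 5 + T e3 e3 e3 * z ^ 6 := by
    intro z
    simp only [P, eval_add, eval_mul, eval_C, eval_X, eval_pow]
  have hP : P ≠ 0 := by
    intro h
    apply t333
    have h0 : ∀ z : ℂ, P.eval z = 0 := fun z => by rw [h, eval_zero]
    simp only [hPe] at h0
    exact (van6 h0).2.2.2.2.2.2
  obtain ⟨θ, hθ⟩ := avoid P P hP hP 1
  refine smoothPf hW T hT hs (det_I hT h0 h1 h2 h3 h11 h12 h13 h22 h23 h33)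
    ((T e2 e2 e2 + 3 * T e2 e2 e3 * θ + 3 * T e2 e3 e3 * θ ^ 2 + T e3 e3 e3 * θ ^ 3) / 3)
    0 1 θ 0 1 0 (by ring) (by rw [hG]; ring) ?_
  intro y0 y1 y2 y3 k1 k2 k3 k4 k5
  have hy2 : y2 = 0 := by linear_combination k1
  by_cases hy1 : y1 = 0
  · rw [hG, hy1, hy2] at k4
    have : T e3 e3 e3 * y3 ^ 3 = 0 := by linear_combination k4
    have hy3 : y3 = 0 := by simpa [t333] using this
    rw [hy1, hy2, hy3, qexp4 hT] at k2
    simp only [map_add, map_smul, smul_eq_mul, hT.2 o e1 o, hT.2 o e2 o, hT.2 o e3 o,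
      hT.1 e1 e2 o, hT.1 e1 e3 o, hT.1 e2 e3 o, hT.2 e1 e1 o, hT.2 e2 e2 o, hT.2 e3 e3 o,
      hT.2 e3 e2 o, hT.2 e3 e1 o, hT.2 e2 e1 o,
      hT.1 e1 o, hT.1 e2 o, hT.1 e3 o, hT.2 o e3 e2, hT.2 o e3 e1, hT.2 o e2 e1,
      h0, h1, h2, h3, h11, h12, h13, h22, h23, h33] at k2
    exact ⟨by linear_combination -k2, hy1, hy2, hy3⟩
  · exfalso
    obtain ⟨d, hd⟩ := IsAlgClosed.exists_pow_nat_eq (θ ^ 2 + 4 * (y3 / y1)) (n := 2) (by norm_num)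
    have root : ∀ z : ℂ, z ^ 2 = θ * z + y3 / y1 → P.eval z = 0 := by
      intro z hz
      have := k5 z (1 / y1)
      rw [hG, hy2] at this
      have a1 : z * 0 + 1 / y1 * y1 = 1 := by field_simp; ring
      have a2 : z * 1 + 1 / y1 * 0 = z := by ring
      have a3 : z * θ + 1 / y1 * y3 = z ^ 2 := by rw [hz]; ring
      rw [a1, a2, a3] at this
      rw [hPe]
      linear_combination this
    refine hθ ((θ + d) / 2) ((θ - d) / 2) (root _ ?_) (root _ ?_) (by ring)
    · linear_combination hd / 4
    · linear_combination hd / 4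

theorem sm3 [FiniteDimensional ℂ W] (hW : Module.finrank ℂ W = 5)
    (T : W →ₗ[ℂ] W →ₗ[ℂ] W →ₗ[ℂ] ℂ) (hT : SymT T) {o e1 e2 e3 e4 : W} (hs : Sp o e1 e2 e3 e4)
    (hns : ∀ o, o ≠ 0 → ∃ v, T o o v ≠ 0)
    (h0 : T o o o = 0) (h1 : T o o e1 = 0) (h2 : T o o e2 = 0) (h3 : T o o e3 = 0)
    (h11 : T o e1 e1 = 0) (h12 : T o e1 e2 = 0) (h13 : T o e1 e3 = 1 / 2) (h22 : T o e2 e2 = -1)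
    (h23 : T o e2 e3 = 0) (h33 : T o e3 e3 = 0) :
    IsPf (fun v => T v v v) := by
  have h21 := (hT.2 o e2 e1).trans h12
  have h31 := (hT.2 o e3 e1).trans h13
  have h32 := (hT.2 o e3 e2).trans h23
  by_cases hz : ∃ z : ℂ, T ((1:ℂ) • e1 + z • e2 + (z ^ 2) • e3) ((1:ℂ) • e1 + z • e2 + (z ^ 2) • e3)
      ((1:ℂ) • e1 + z • e2 + (z ^ 2) • e3) ≠ 0
  · obtain ⟨z, hz⟩ := hz
    refine sm3a hW T hT (o := o) (e1 := e3) (e2 := e2 + (2 * z) • e3)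
      (e3 := (1:ℂ) • e1 + z • e2 + (z ^ 2) • e3) (e4 := e4)
      (hs.chg _ _ _ _ _ ⟨1, 0, 0, 0, 0, by module⟩ ⟨0, z ^ 2, -z, 1, 0, by module⟩
      ⟨0, -2 * z, 1, 0, 0, by module⟩ ⟨0, 1, 0, 0, 0, by module⟩ ⟨0, 0, 0, 0, 1, by module⟩)
      h0 h3 ?_ ?_ h33 ?_ ?_ ?_ ?_ ?_ hz
    all_goals simp [h1, h2, h3, h11, h12, h13, h21, h22, h23, h31, h32, h33]
    all_goals ring
  · exfalso
    push Not at hz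
    simp only [exp3 hT] at hz
    obtain ⟨k0, k1, k2, k3, k4, k5, k6⟩ := van6 (c0 := T e1 e1 e1) (c1 := 3 * T e1 e1 e2)
      (c2 := 3 * T e1 e1 e3 + 3 * T e1 e2 e2) (c3 := 6 * T e1 e2 e3 + T e2 e2 e2)
      (c4 := 3 * T e1 e3 e3 + 3 * T e2 e2 e3) (c5 := 3 * T e2 e3 e3) (c6 := T e3 e3 e3)
      (fun z => by linear_combination hz z)
    have q1 : T e1 e1 e2 = 0 := by linear_combination k1 / 3
    have q2 : T e1 e2 e2 = - T e1 e1 e3 := by linear_combination k2 / 3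
    have q3 : T e2 e2 e2 = -6 * T e1 e2 e3 := by linear_combination k3
    have q4 : T e2 e2 e3 = - T e1 e3 e3 := by linear_combination k4 / 3
    have q5 : T e2 e3 e3 = 0 := by linear_combination k5 / 3
    refine noSing hT hs hns (fun a b => (-(T e1 e1 e3 * a ^ 2 + 2 * T e1 e2 e3 * a * b
        + T e1 e3 e3 * b ^ 2)) • o + (a ^ 2) • e1 + (a * b) • e2 + (b ^ 2) • e3)
      ((- T e1 e1 e3) • o + e1) ((-2 * T e1 e2 e3) • o + e2) ((- T e1 e3 e3) • o + e3)
      (fun a b => by module) ?_ ?_ ?_ ?_ ?_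
    · intro a b hab h
      obtain ⟨-, p, -, q⟩ := hs.indep hW h
      simp at p q; simp [p, q] at hab
    all_goals
      intro a b
      rw [qexp4 hT]
      simp only [hT.2 o e1 o, hT.2 o e2 o, hT.2 o e3 o,
        hT.1 e1 e2 o, hT.1 e1 e3 o, hT.1 e2 e3 o, hT.2 e1 e1 o, hT.2 e2 e2 o, hT.2 e3 e3 o,
        hT.2 e3 e2 o, hT.2 e3 e1 o, hT.2 e2 e1 o,
        hT.1 e1 o, hT.1 e2 o, hT.1 e3 o, hT.2 o e3 e2, hT.2 o e3 e1, hT.2 o e2 e1,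
        hT.2 e1 e2 e1, hT.2 e1 e3 e1, hT.2 e1 e3 e2, hT.2 e2 e2 e1, hT.2 e2 e3 e1, hT.2 e2 e3 e2,
        hT.2 e3 e3 e1, hT.2 e3 e3 e2, hT.1 e2 e1, hT.1 e3 e1, hT.1 e3 e2,
        h0, h1, h2, h3, h11, h12, h13, h22, h23, h33, q1, q2, q3, q4, q5, k0, k6]
      ring

end CubicPf


set_option linter.unusedSimpArgs false

namespace CubicPf

variable {W : Type*} [AddCommGroup W] [Module ℂ W]

open Polynomial in
theorem sm2a [FiniteDimensional ℂ W] (hW : Module.finrank ℂ W = 5)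
    (T : W →ₗ[ℂ] W →ₗ[ℂ] W →ₗ[ℂ] ℂ) (hT : SymT T) {o e1 e2 e3 e4 : W} (hs : Sp o e1 e2 e3 e4)
    (h0 : T o o o = 0) (h1 : T o o e1 = 0) (h2 : T o o e2 = 0) (h3 : T o o e3 = 0)
    (h11 : T o e1 e1 = 0) (h12 : T o e1 e2 = 1 / 2) (h13 : T o e1 e3 = 0) (h22 : T o e2 e2 = 0)
    (h23 : T o e2 e3 = 0) (h33 : T o e3 e3 = 0) (t222 : T e2 e2 e2 = 0)
    (hk1 : ¬ (T e2 e2 e2 = 0 ∧ T e2 e2 e3 = 0 ∧ T e2 e3 e3 = 0 ∧ T e3 e3 e3 = 0))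
    (hk2 : ¬ (T e1 e1 e1 = 0 ∧ T e1 e1 e3 = 0 ∧ T e1 e3 e3 = 0 ∧ T e3 e3 e3 = 0))
    (c : ℂ) (hc0 : c ≠ 0) (hc : T e3 e3 e3 = 0 → T e1 e3 e3 + c * T e2 e3 e3 ≠ 0) :
    IsPf (fun v => T v v v) := by
  have hG : ∀ x0 x1 x2 x3, G4 T o e1 e2 e3 x0 x1 x2 x3 = 3 * x0 * x1 * x2
      + (T e1 e1 e1 * x1 ^ 3 + 3 * T e1 e1 e2 * x1 ^ 2 * x2 + 3 * T e1 e1 e3 * x1 ^ 2 * x3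
        + 3 * T e1 e2 e2 * x1 * x2 ^ 2 + 6 * T e1 e2 e3 * x1 * x2 * x3 + 3 * T e1 e3 e3 * x1 * x3 ^ 2
        + T e2 e2 e2 * x2 ^ 3 + 3 * T e2 e2 e3 * x2 ^ 2 * x3 + 3 * T e2 e3 e3 * x2 * x3 ^ 2
        + T e3 e3 e3 * x3 ^ 3) := by
    intro x0 x1 x2 x3
    rw [G4, exp4 hT, h0, h1, h2, h3, h11, h12, h13, h22, h23, h33]; ring
  have cub : ∀ c0 c1 c2 c3 : ℂ, ¬ (c0 = 0 ∧ c1 = 0 ∧ c2 = 0 ∧ c3 = 0) → ∃ P : ℂ[X], P ≠ 0 ∧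
      ∀ z, P.eval z = c0 + 3 * c1 * z + 3 * c2 * z ^ 2 + c3 * z ^ 3 := by
    intro c0 c1 c2 c3 hc
    refine ⟨C c0 + C (3 * c1) * X + C (3 * c2) * X ^ 2 + C c3 * X ^ 3, ?_, ?_⟩
    · intro h
      apply hc
      have := van6 (c0 := c0) (c1 := 3 * c1) (c2 := 3 * c2) (c3 := c3) (c4 := 0) (c5 := 0) (c6 := 0)
        (fun z => by
          have := congrArg (eval z) h
          simp only [eval_add, eval_mul, eval_C, eval_X, eval_pow, eval_zero] at this
          linear_combination this)
      simpa using this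
    · intro z
      simp only [eval_add, eval_mul, eval_C, eval_X, eval_pow]
  obtain ⟨P, hP, hPe⟩ := cub _ _ _ _ hk2
  obtain ⟨Q, hQ, hQe⟩ := cub _ _ _ _ hk1
  obtain ⟨θ, hθ⟩ := avoid P Q hP hQ c
  refine smoothPf hW T hT hs (det_II hT h0 h1 h2 h3 h11 h13 h22 h23 h33 t222)
    (-(T e1 e1 e1 + 3 * T e1 e1 e2 * c + 3 * T e1 e1 e3 * θ
        + 3 * T e1 e2 e2 * c ^ 2 + 6 * T e1 e2 e3 * c * θ + 3 * T e1 e3 e3 * θ ^ 2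
        + T e2 e2 e2 * c ^ 3 + 3 * T e2 e2 e3 * c ^ 2 * θ + 3 * T e2 e3 e3 * c * θ ^ 2
        + T e3 e3 e3 * θ ^ 3) / (3 * c))
    1 c θ 1 0 0 (by ring) (by rw [hG]; field_simp; ring) ?_
  intro y0 y1 y2 y3 k1 k2 k3 k4 k5
  have hy1 : y1 = 0 := by linear_combination k1
  generalize (-(T e1 e1 e1 + 3 * T e1 e1 e2 * c + 3 * T e1 e1 e3 * θ
        + 3 * T e1 e2 e2 * c ^ 2 + 6 * T e1 e2 e3 * c * θ + 3 * T e1 e3 e3 * θ ^ 2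
        + T e2 e2 e2 * c ^ 3 + 3 * T e2 e2 e3 * c ^ 2 * θ + 3 * T e2 e3 e3 * c * θ ^ 2
        + T e3 e3 e3 * θ ^ 3) / (3 * c)) = t at k2 k3 k5
  by_cases hy2 : y2 = 0
  · have hy3 : y3 = 0 := by
      rw [hG, hy1, hy2] at k4
      by_cases t333 : T e3 e3 e3 = 0
      · have hn := hc t333
        rw [hT.1, hT.2, qexp4 hT, hy1, hy2] at k3
        simp only [map_add, map_smul, smul_eq_mul, hT.2 o e3 o, hT.2 e3 e3 o, hT.1 e3 o,
          hT.2 o e3 e1, hT.2 o e3 e2, hT.2 e3 e3 e1, hT.2 e3 e3 e2, hT.1 e3 e1, hT.1 e3 e2,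
          h0, h1, h2, h3, h13, h23, h33, t333] at k3
        have : (T e1 e3 e3 + c * T e2 e3 e3) * y3 ^ 2 = 0 := by linear_combination k3
        simpa [hn] using this
      · have : T e3 e3 e3 * y3 ^ 3 = 0 := by linear_combination k4
        simpa [t333] using this
    rw [hy1, hy2, hy3, qexp4 hT] at k2
    simp only [map_add, map_smul, smul_eq_mul, hT.2 o e1 o, hT.2 o e2 o, hT.2 o e3 o,
      hT.1 e1 e2 o, hT.1 e1 e3 o, hT.1 e2 e3 o, hT.2 e1 e1 o, hT.2 e2 e2 o, hT.2 e3 e3 o,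
      hT.2 e3 e2 o, hT.2 e3 e1 o, hT.2 e2 e1 o,
      hT.1 e1 o, hT.1 e2 o, hT.1 e3 o, hT.2 o e3 e2, hT.2 o e3 e1, hT.2 o e2 e1,
      h0, h1, h2, h3, h11, h12, h13, h22, h23, h33] at k2
    have : c * y0 = 0 := by linear_combination k2
    exact ⟨by simpa [hc0] using this, hy1, hy2, hy3⟩
  · exfalso
    refine hθ (θ - c * (y3 / y2)) (y3 / y2) ?_ ?_ (by ring)
    · have := k5 1 (-c / y2)
      rw [hG, hy1] at this
      have a2 : 1 * c + -c / y2 * y2 = 0 := by field_simp; ring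
      rw [a2] at this
      rw [hPe]
      linear_combination this
    · rw [hG, hy1] at k4
      rw [hQe]
      field_simp
      linear_combination k4

theorem k1ne [FiniteDimensional ℂ W] (hW : Module.finrank ℂ W = 5)
    (T : W →ₗ[ℂ] W →ₗ[ℂ] W →ₗ[ℂ] ℂ) (hT : SymT T) {o e1 e2 e3 e4 : W} (hs : Sp o e1 e2 e3 e4)
    (hns : ∀ o, o ≠ 0 → ∃ v, T o o v ≠ 0)
    (h0 : T o o o = 0) (h1 : T o o e1 = 0) (h2 : T o o e2 = 0) (h3 : T o o e3 = 0)
    (h12 : T o e1 e2 = 1 / 2) (h13 : T o e1 e3 = 0) (h22 : T o e2 e2 = 0)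
    (h23 : T o e2 e3 = 0) (h33 : T o e3 e3 = 0) :
    ¬ (T e2 e2 e2 = 0 ∧ T e2 e2 e3 = 0 ∧ T e2 e3 e3 = 0 ∧ T e3 e3 e3 = 0) := by
  rintro ⟨q1, q2, q3, q4⟩
  by_cases q : T e1 e3 e3 = 0
  · refine noSing hT hs hns (fun a b => (a ^ 2) • o + (0:ℂ) • e1 + (0:ℂ) • e2 + (b ^ 2) • e3)
      o 0 e3 (fun a b => by module) ?_ ?_ ?_ ?_ ?_
    · intro a b hab h
      obtain ⟨p, -, -, q⟩ := hs.indep hW h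
      simp at p q; simp [p, q] at hab
    all_goals
      intro a b
      rw [qexp4 hT]
      simp only [hT.2 o e1 o, hT.2 o e2 o, hT.2 o e3 o,
        hT.1 e1 e2 o, hT.1 e1 e3 o, hT.1 e2 e3 o, hT.2 e1 e1 o, hT.2 e2 e2 o, hT.2 e3 e3 o,
        hT.2 e3 e2 o, hT.2 e3 e1 o, hT.2 e2 e1 o,
        hT.1 e1 o, hT.1 e2 o, hT.1 e3 o, hT.2 o e3 e2, hT.2 o e3 e1, hT.2 o e2 e1,
        hT.2 e1 e2 e1, hT.2 e1 e3 e1, hT.2 e1 e3 e2, hT.2 e2 e2 e1, hT.2 e2 e3 e1, hT.2 e2 e3 e2,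
        hT.2 e3 e3 e1, hT.2 e3 e3 e2, hT.1 e2 e1, hT.1 e3 e1, hT.1 e3 e2,
        h0, h1, h2, h3, h12, h13, h22, h23, h33, q1, q2, q3, q4, q]
      ring
  · refine noSing hT hs hns (fun a b => (-(T e1 e3 e3 * b ^ 2 + T e1 e2 e2 * a ^ 2
        + 2 * T e1 e2 e3 * a * b)) • o + (0:ℂ) • e1 + (a ^ 2) • e2 + (a * b) • e3)
      ((- T e1 e2 e2) • o + e2) ((-2 * T e1 e2 e3) • o + e3) ((- T e1 e3 e3) • o)
      (fun a b => by module) ?_ ?_ ?_ ?_ ?_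
    · intro a b hab h
      obtain ⟨p, -, r, -⟩ := hs.indep hW h
      simp at r; rw [r] at p
      have : T e1 e3 e3 * b ^ 2 = 0 := by linear_combination -p
      simp [q] at this
      simp [r, this] at hab
    all_goals
      intro a b
      rw [qexp4 hT]
      simp only [hT.2 o e1 o, hT.2 o e2 o, hT.2 o e3 o,
        hT.1 e1 e2 o, hT.1 e1 e3 o, hT.1 e2 e3 o, hT.2 e1 e1 o, hT.2 e2 e2 o, hT.2 e3 e3 o,
        hT.2 e3 e2 o, hT.2 e3 e1 o, hT.2 e2 e1 o,
        hT.1 e1 o, hT.1 e2 o, hT.1 e3 o, hT.2 o e3 e2, hT.2 o e3 e1, hT.2 o e2 e1,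
        hT.2 e1 e2 e1, hT.2 e1 e3 e1, hT.2 e1 e3 e2, hT.2 e2 e2 e1, hT.2 e2 e3 e1, hT.2 e2 e3 e2,
        hT.2 e3 e3 e1, hT.2 e3 e3 e2, hT.1 e2 e1, hT.1 e3 e1, hT.1 e3 e2,
        h0, h1, h2, h3, h12, h13, h22, h23, h33, q1, q2, q3, q4]
      ring

theorem sm2b [FiniteDimensional ℂ W] (hW : Module.finrank ℂ W = 5)
    (T : W →ₗ[ℂ] W →ₗ[ℂ] W →ₗ[ℂ] ℂ) (hT : SymT T) {o e1 e2 e3 e4 : W} (hs : Sp o e1 e2 e3 e4)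
    (hns : ∀ o, o ≠ 0 → ∃ v, T o o v ≠ 0)
    (h0 : T o o o = 0) (h1 : T o o e1 = 0) (h2 : T o o e2 = 0) (h3 : T o o e3 = 0)
    (h11 : T o e1 e1 = 0) (h12 : T o e1 e2 = 1 / 2) (h13 : T o e1 e3 = 0) (h22 : T o e2 e2 = 0)
    (h23 : T o e2 e3 = 0) (h33 : T o e3 e3 = 0) (t222 : T e2 e2 e2 = 0)
    (hn : T e3 e3 e3 = 0 → T e2 e3 e3 ≠ 0) :
    IsPf (fun v => T v v v) := by
  have a1 := k1ne hW T hT hs hns h0 h1 h2 h3 h12 h13 h22 h23 h33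
  have a2 := k1ne hW T hT (o := o) (e1 := e2) (e2 := e1) (e3 := e3) (e4 := e4)
    (hs.chg _ _ _ _ _ ⟨1, 0, 0, 0, 0, by module⟩ ⟨0, 0, 1, 0, 0, by module⟩
      ⟨0, 1, 0, 0, 0, by module⟩ ⟨0, 0, 0, 1, 0, by module⟩ ⟨0, 0, 0, 0, 1, by module⟩)
    hns h0 h2 h1 h3 ((hT.2 _ _ _).trans h12) h23 h11 h13 h33
  by_cases hc : T e3 e3 e3 = 0 → T e1 e3 e3 + 1 * T e2 e3 e3 ≠ 0
  · exact sm2a hW T hT hs h0 h1 h2 h3 h11 h12 h13 h22 h23 h33 t222 a1 a2 1 one_ne_zero hc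
  · refine sm2a hW T hT hs h0 h1 h2 h3 h11 h12 h13 h22 h23 h33 t222 a1 a2 (-1) (by norm_num) ?_
    push Not at hc
    intro h h'
    apply hn h
    linear_combination (hc.2 - h') / 2

theorem sm2c [FiniteDimensional ℂ W] (hW : Module.finrank ℂ W = 5)
    (T : W →ₗ[ℂ] W →ₗ[ℂ] W →ₗ[ℂ] ℂ) (hT : SymT T) {o e1 e2 e3 e4 : W} (hs : Sp o e1 e2 e3 e4)
    (hns : ∀ o, o ≠ 0 → ∃ v, T o o v ≠ 0)
    (h0 : T o o o = 0) (h1 : T o o e1 = 0) (h2 : T o o e2 = 0) (h3 : T o o e3 = 0)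
    (h11 : T o e1 e1 = 0) (h12 : T o e1 e2 = 1 / 2) (h13 : T o e1 e3 = 0) (h22 : T o e2 e2 = 0)
    (h23 : T o e2 e3 = 0) (h33 : T o e3 e3 = 0)
    (hn : T e3 e3 e3 = 0 → T e2 e3 e3 ≠ 0) :
    IsPf (fun v => T v v v) := by
  obtain ⟨z, hz⟩ : ∃ z : ℂ, T e2 e2 e2 + 3 * T e2 e2 e3 * z + 3 * T e2 e3 e3 * z ^ 2
      + T e3 e3 e3 * z ^ 3 = 0 := by
    by_cases t : T e3 e3 e3 = 0
    · obtain ⟨a, b, hab, hr⟩ := binroot2 (3 * T e2 e3 e3) (3 * T e2 e2 e3) (T e2 e2 e2)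
      have ha : a ≠ 0 := by
        rintro rfl
        have hb : b ≠ 0 := by tauto
        have : T e2 e3 e3 * b ^ 2 = 0 := by linear_combination hr / 3
        simp [hn t, hb] at this
      refine ⟨b / a, ?_⟩
      rw [t]; field_simp; linear_combination a * hr
    · obtain ⟨a, b, hab, hr⟩ := binroot3 (T e3 e3 e3) (3 * T e2 e3 e3) (3 * T e2 e2 e3) (T e2 e2 e2)
      have ha : a ≠ 0 := by
        rintro rfl
        have hb : b ≠ 0 := by tauto
        have : T e3 e3 e3 * b ^ 3 = 0 := by linear_combination hr
        simp [t, hb] at this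
      refine ⟨b / a, ?_⟩
      field_simp; linear_combination hr
  refine sm2b hW T hT (o := o) (e1 := e1) (e2 := e2 + z • e3) (e3 := e3) (e4 := e4)
    (hs.chg _ _ _ _ _ ⟨1, 0, 0, 0, 0, by module⟩ ⟨0, 1, 0, 0, 0, by module⟩
    ⟨0, 0, 1, -z, 0, by module⟩ ⟨0, 0, 0, 1, 0, by module⟩ ⟨0, 0, 0, 0, 1, by module⟩) hns
    h0 h1 (by simp [h2, h3]) h3 h11 (by simp [h12, h13]) h13
    (by simp [h22, h23, h33, (hT.2 o e3 e2).trans h23]) (by simp [h23, h33]) h33 ?_ ?_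
  · have := exp2 hT e2 e3 1 z
    rw [one_smul] at this
    rw [this]; linear_combination hz
  · intro t
    simpa [t] using hn t

theorem sm2 [FiniteDimensional ℂ W] (hW : Module.finrank ℂ W = 5)
    (T : W →ₗ[ℂ] W →ₗ[ℂ] W →ₗ[ℂ] ℂ) (hT : SymT T) {o e1 e2 e3 e4 : W} (hs : Sp o e1 e2 e3 e4)
    (hns : ∀ o, o ≠ 0 → ∃ v, T o o v ≠ 0)
    (h0 : T o o o = 0) (h1 : T o o e1 = 0) (h2 : T o o e2 = 0) (h3 : T o o e3 = 0)
    (h11 : T o e1 e1 = 0) (h12 : T o e1 e2 = 1 / 2) (h13 : T o e1 e3 = 0) (h22 : T o e2 e2 = 0)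
    (h23 : T o e2 e3 = 0) (h33 : T o e3 e3 = 0) :
    IsPf (fun v => T v v v) := by
  by_cases hn : T e3 e3 e3 = 0 → T e2 e3 e3 ≠ 0
  · exact sm2c hW T hT hs hns h0 h1 h2 h3 h11 h12 h13 h22 h23 h33 hn
  by_cases hn' : T e3 e3 e3 = 0 → T e1 e3 e3 ≠ 0
  · exact sm2c hW T hT (o := o) (e1 := e2) (e2 := e1) (e3 := e3) (e4 := e4)
      (hs.chg _ _ _ _ _ ⟨1, 0, 0, 0, 0, by module⟩ ⟨0, 0, 1, 0, 0, by module⟩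
      ⟨0, 1, 0, 0, 0, by module⟩ ⟨0, 0, 0, 1, 0, by module⟩ ⟨0, 0, 0, 0, 1, by module⟩)
      hns h0 h2 h1 h3 h22 ((hT.2 _ _ _).trans h12) h23 h11 h13 h33 hn'
  push Not at hn hn'
  exfalso
  refine noSing hT hs hns (fun a b => (a ^ 2) • o + (b ^ 2) • e3)
      o 0 e3 (fun a b => by module) ?_ ?_ ?_ ?_ ?_
  · intro a b hab h
    have h : (a ^ 2) • o + (0:ℂ) • e1 + (0:ℂ) • e2 + (b ^ 2) • e3 = 0 := by
      simpa using h
    obtain ⟨p, -, -, q⟩ := hs.indep hW h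
    simp at p q; simp [p, q] at hab
  all_goals
    intro a b
    rw [qexp2 hT]
    simp only [hT.2 o e3 o, hT.2 e3 e3 o, hT.1 e3 o, hT.2 o e3 e2, hT.2 o e3 e1,
        hT.2 e3 e3 e1, hT.2 e3 e3 e2, hT.1 e3 e1, hT.1 e3 e2,
        h0, h1, h2, h3, h13, h23, h33, hn.1, hn.2, hn'.2]
    ring

end CubicPf


set_option linter.unusedSimpArgs false

namespace CubicPf

variable {W : Type*} [AddCommGroup W] [Module ℂ W]

theorem frame [FiniteDimensional ℂ W] (hW : Module.finrank ℂ W = 5)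
    (T : W →ₗ[ℂ] W →ₗ[ℂ] W →ₗ[ℂ] ℂ) (hT : SymT T)
    (hns : ∀ o, o ≠ 0 → ∃ v, T o o v ≠ 0) {o : W} (ho0 : o ≠ 0) (hf : T o o o = 0) :
    ∃ (y : Fin 3 → W) (e4 : W), Sp o (y 0) (y 1) (y 2) e4 ∧ (∀ i, T o o (y i) = 0) ∧
      T o o e4 ≠ 0 ∧ (∀ v, T o o v = 0 → ∃ c c0 c1 c2 : ℂ, v = c • o + c0 • y 0 + c1 • y 1 + c2 • y 2) ∧
      (∀ i j, i ≠ j → T o (y i) (y j) = 0) ∧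
      (∀ i, T o (y i) (y i) = 0 ∨ T o (y i) (y i) = 1) ∧
      (∀ i j, i ≤ j → T o (y j) (y j) = 1 → T o (y i) (y i) = 1) := by
  obtain ⟨e4, he4⟩ := hns o ho0
  have hK : Module.finrank ℂ (LinearMap.ker (T o o)) = 4 := by
    have hr := LinearMap.finrank_range_add_finrank_ker (T o o)
    have hsurj : LinearMap.range (T o o) = ⊤ := by
      rw [LinearMap.range_eq_top]
      intro c
      refine ⟨(c / T o o e4) • e4, ?_⟩
      simp; field_simp
    rw [hsurj, finrank_top, Module.finrank_self, hW] at hr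
    omega
  obtain ⟨U, hU0, hU1, hU2, hU3⟩ := compl_in o ho0 (LinearMap.ker (T o o)) (by simpa using hf)
  have hU4 : Module.finrank ℂ U = 3 := by
    rw [hK] at hU3; omega
  obtain ⟨y, -, hyU, hys, hyo, hyd, hym⟩ := diag U hU4 (T o) (hT.2 o)
  have hker : ∀ v, T o o v = 0 → ∃ c c0 c1 c2 : ℂ, v = c • o + c0 • y 0 + c1 • y 1 + c2 • y 2 := by
    intro v hv
    obtain ⟨c, u, hu, rfl⟩ := hU2 v (by simpa using hv)
    obtain ⟨d, rfl⟩ := hys u hu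
    refine ⟨c, d 0, d 1, d 2, ?_⟩
    rw [Fin.sum_univ_three]; module
  refine ⟨y, e4, ?_, ?_, he4, hker, hyo, hyd, hym⟩
  · intro v
    obtain ⟨c, c0, c1, c2, h⟩ := hker (v - (T o o v / T o o e4) • e4) (by simp; field_simp; simp)
    refine ⟨c, c0, c1, c2, T o o v / T o o e4, ?_⟩
    rw [← h]; module
  · intro i
    simpa using hU0 (hyU i)

theorem rank2 [FiniteDimensional ℂ W] (hW : Module.finrank ℂ W = 5)
    (T : W →ₗ[ℂ] W →ₗ[ℂ] W →ₗ[ℂ] ℂ) (hT : SymT T)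
    (hns : ∀ o, o ≠ 0 → ∃ v, T o o v ≠ 0) {o : W} (hf : T o o o = 0)
    {y0 y1 y2 e4 : W} (hs : Sp o y0 y1 y2 e4) (k0 : T o o y0 = 0) (k1 : T o o y1 = 0)
    (k2 : T o o y2 = 0) (h01 : T o y0 y1 = 0) (h02 : T o y0 y2 = 0) (h12 : T o y1 y2 = 0)
    (h00 : T o y0 y0 = 1) (h11 : T o y1 y1 = 1) (h22 : T o y2 y2 = 0 ∨ T o y2 y2 = 1) :
    IsPf (fun v => T v v v) := by
  have hI : Complex.I * Complex.I = -1 := Complex.I_mul_I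
  have h10 := (hT.2 o y1 y0).trans h01
  have h20 := (hT.2 o y2 y0).trans h02
  have h21 := (hT.2 o y2 y1).trans h12
  have J1 : y1 = (-(Complex.I * Complex.I)) • y1 := by rw [hI]; simp
  have J2 : y2 = (-(Complex.I * Complex.I)) • y2 := by rw [hI]; simp
  rcases h22 with h22 | h22
  · refine sm2 hW T hT (o := o) (e1 := (1 / 4 : ℂ) • y0 + (Complex.I / 4) • y1)
      (e2 := y0 - Complex.I • y1) (e3 := y2) (e4 := e4)
      (hs.chg _ _ _ _ _ ⟨1, 0, 0, 0, 0, by module⟩ ⟨0, 2, 1 / 2, 0, 0, by module⟩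
        ⟨0, -2 * Complex.I, Complex.I / 2, 0, 0, ?_⟩ ⟨0, 0, 0, 1, 0, by module⟩
        ⟨0, 0, 0, 0, 1, by module⟩) hns hf ?_ ?_ k2 ?_ ?_ ?_ ?_ ?_ h22
    · nth_rewrite 1 [J1]; module
    · simp [k0, k1]
    · simp [k0, k1]
    · simp [h00, h01, h10, h11]; linear_combination (1 / 16) * hI
    · simp [h00, h01, h10, h11]; linear_combination (-1 / 4) * hI
    · simp [h02, h12]
    · simp [h00, h01, h10, h11]
    · simp [h02, h12]
  · refine sm3 hW T hT (o := o) (e1 := y0 + Complex.I • y1) (e2 := Complex.I • y2)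
      (e3 := (1 / 4 : ℂ) • y0 - (Complex.I / 4) • y1) (e4 := e4)
      (hs.chg _ _ _ _ _ ⟨1, 0, 0, 0, 0, by module⟩ ⟨0, 1 / 2, 0, 2, 0, by module⟩
        ⟨0, -Complex.I / 2, 0, 2 * Complex.I, 0, ?_⟩ ⟨0, 0, -Complex.I, 0, 0, ?_⟩
        ⟨0, 0, 0, 0, 1, by module⟩) hns hf ?_ ?_ ?_ ?_ ?_ ?_ ?_ ?_ ?_
    · nth_rewrite 1 [J1]; module
    · nth_rewrite 1 [J2]; module
    · simp [k0, k1]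
    · simp [k2]
    · simp [k0, k1]
    · simp [h00, h01, h10, h11]
    · simp [h02, h12]
    · simp [h00, h01, h10, h11]; linear_combination (-1 / 4) * hI
    · simp [h22]
    · simp [h20, h21]
    · simp [h00, h01, h10, h11]; linear_combination (1 / 16) * hI

theorem lemX [FiniteDimensional ℂ W] (hW : Module.finrank ℂ W = 5)
    (T : W →ₗ[ℂ] W →ₗ[ℂ] W →ₗ[ℂ] ℂ) (hT : SymT T)
    (hns : ∀ o, o ≠ 0 → ∃ v, T o o v ≠ 0) {o : W} (ho0 : o ≠ 0) (hf : T o o o = 0)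
    {u v : W} (hu : T o o u = 0) (hv : T o o v = 0)
    (hd : T o u u * T o v v - T o u v ^ 2 ≠ 0) : IsPf (fun v => T v v v) := by
  obtain ⟨y, e4, hs, hk, -, hker, hyo, hyd, hym⟩ := frame hW T hT hns ho0 hf
  rcases hyd 1 with d1 | d1
  · exfalso
    have d2 : T o (y 2) (y 2) = 0 := by
      rcases hyd 2 with d | d
      · exact d
      · have := hym 1 2 (by decide) d
        rw [d1] at this; simp at this
    apply hd
    obtain ⟨c, c0, c1, c2, rfl⟩ := hker u hu
    obtain ⟨d, d0, d1', d2', rfl⟩ := hker v hv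
    have hk' : ∀ i, T o (y i) o = 0 := fun i => by rw [hT.2, hk]
    simp [hf, hk, hk', d1, d2, hyo 0 1 (by decide), hyo 0 2 (by decide), hyo 1 2 (by decide),
      hyo 1 0 (by decide), hyo 2 0 (by decide), hyo 2 1 (by decide)]
    ring
  · exact rank2 hW T hT hns hf hs (hk 0) (hk 1) (hk 2) (hyo 0 1 (by decide)) (hyo 0 2 (by decide))
      (hyo 1 2 (by decide)) (hym 0 1 (by decide) d1) d1 (hyd 2)

theorem smoothAll [FiniteDimensional ℂ W] (hW : Module.finrank ℂ W = 5)
    (T : W →ₗ[ℂ] W →ₗ[ℂ] W →ₗ[ℂ] ℂ) (hT : SymT T)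
    (hns : ∀ o, o ≠ 0 → ∃ v, T o o v ≠ 0) {o : W} (ho0 : o ≠ 0) (hf : T o o o = 0) :
    IsPf (fun v => T v v v) := by
  obtain ⟨y, e4, hs, hk, he4, hker, hyo, hyd, hym⟩ := frame hW T hT hns ho0 hf
  rcases hyd 1 with d1 | d1
  swap
  · exact rank2 hW T hT hns hf hs (hk 0) (hk 1) (hk 2) (hyo 0 1 (by decide)) (hyo 0 2 (by decide))
      (hyo 1 2 (by decide)) (hym 0 1 (by decide) d1) d1 (hyd 2)
  have d2 : T o (y 2) (y 2) = 0 := by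
    rcases hyd 2 with d | d
    · exact d
    · have := hym 1 2 (by decide) d
      rw [d1] at this; simp at this
  have hk' : ∀ i, T o (y i) o = 0 := fun i => by rw [hT.2, hk]
  obtain ⟨a, b, hab, hr⟩ := binroot3 (T (y 1) (y 1) (y 1)) (3 * T (y 1) (y 1) (y 2))
    (3 * T (y 1) (y 2) (y 2)) (T (y 2) (y 2) (y 2))
  obtain ⟨V0, hV0⟩ : ∃ V0, V0 = b • y 1 + a • y 2 := ⟨_, rfl⟩
  have V0c : T V0 V0 V0 = 0 := by rw [hV0, exp2 hT]; linear_combination hr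
  have V00 : T o V0 V0 = 0 := by
    rw [hV0]; simp [d1, d2, hyo 1 2 (by decide), hyo 2 1 (by decide)]
  have V0o : T o V0 o = 0 := by rw [hV0]; simp [hk']
  have V0y : ∀ i, T o V0 (y i) = 0 := by
    intro i
    rw [hV0]
    fin_cases i <;> simp [d1, d2, hyo 1 2 (by decide), hyo 2 1 (by decide), hyo 1 0 (by decide),
      hyo 2 0 (by decide)]
  obtain ⟨s, hsd⟩ : ∃ s, s = -(T o V0 e4 / T o o e4) := ⟨_, rfl⟩
  obtain ⟨V, hV⟩ : ∃ V, V = V0 + s • o := ⟨_, rfl⟩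
  have hoV : ∀ w, T o V w = 0 := by
    intro w
    obtain ⟨x0, x1, x2, x3, x4, rfl⟩ := hs w
    have h4 : T o V0 e4 + s * T o o e4 = 0 := by rw [hsd]; field_simp; ring
    rw [hV]
    simp [V0o, V0y, hk, hf]
    linear_combination x4 * h4
  have hVc : T V V V = 0 := by
    have e1 : T V V V = T V V V0 := by
      nth_rewrite 3 [hV]; simp [hT.2 V V o, hT.1 V o, hoV]
    have e2 : T V V V0 = T V V0 V0 := by
      rw [hT.2]
      nth_rewrite 2 [hV]; simp [hT.2 V V0 o, hT.1 V o, hoV]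
    rw [e1, e2, hV]
    simp [V0c, V00]
  have hVo : ∀ w, T V o w = 0 := fun w => by rw [hT.1, hoV]
  have hVVo : T V V o = 0 := by rw [hT.2, hVo]
  have indep : ∀ α β : ℂ, α • o + β • V = 0 → α = 0 ∧ β = 0 := by
    intro α β h
    have h' : (α + β * s) • o + (0:ℂ) • y 0 + (β * b) • y 1 + (β * a) • y 2 = 0 := by
      rw [← h, hV, hV0]; module
    obtain ⟨p, -, q, r⟩ := hs.indep hW h'
    have hβ : β = 0 := by
      rcases hab with h | h
      · simpa [h] using r
      · simpa [h] using q
    rw [hβ] at p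
    exact ⟨by linear_combination p, hβ⟩
  have hl : ∃ i, T V V (y i) ≠ 0 := by
    by_contra hcon
    push Not at hcon
    obtain ⟨c, d, hcd, hr⟩ := binroot2 (T o o e4) 0 (T V V e4)
    have hne : d • o + c • V ≠ 0 := by
      intro h
      obtain ⟨p, q⟩ := indep _ _ h
      simp [p, q] at hcd
    obtain ⟨w, hw⟩ := hns _ hne
    apply hw
    obtain ⟨x0, x1, x2, x3, x4, rfl⟩ := hs w
    have h4 : T (d • o + c • V) (d • o + c • V) e4 = 0 := by
      rw [qexp2 hT, hoV]; linear_combination hr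
    have h0 : T (d • o + c • V) (d • o + c • V) o = 0 := by
      rw [qexp2 hT, hoV, hf, hVVo]; ring
    have hi : ∀ i, T (d • o + c • V) (d • o + c • V) (y i) = 0 := by
      intro i
      rw [qexp2 hT, hoV, hk, hcon]; ring
    generalize d • o + c • V = q at h4 h0 hi ⊢
    simp [h4, h0, hi]
  obtain ⟨i, hi⟩ := hl
  obtain ⟨z, hz⟩ : ∃ z, z = -(T o o e4 + T V V e4) / T V V (y i) := ⟨_, rfl⟩
  have hz' : T o o e4 + T V V e4 + z * T V V (y i) = 0 := by rw [hz]; field_simp; ring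
  refine lemX hW T hT hns (o := o + V) (u := o) (v := e4 + z • y i) ?_ ?_ ?_ ?_ ?_
  · intro h
    have := indep 1 1 (by simpa using h)
    simp at this
  · simp [hf, hoV, hVo, hVVo, hVc, (hT.2 o o V).trans (hoV o)]
  · simp [hf, hoV, hVo, hVVo]
  · simp [hoV, hVo, hk]; linear_combination hz'
  · simp [hf, hoV, hVo, hk, he4]

theorem all [FiniteDimensional ℂ W] (hW : Module.finrank ℂ W = 5)
    (T : W →ₗ[ℂ] W →ₗ[ℂ] W →ₗ[ℂ] ℂ) (hT : SymT T) : IsPf (fun v => T v v v) := by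
  by_cases hns : ∀ o, o ≠ 0 → ∃ v, T o o v ≠ 0
  · let b := Module.finBasisOfFinrankEq ℂ W hW
    obtain ⟨a, c, hac, hr⟩ := binroot3 (T (b 0) (b 0) (b 0)) (3 * T (b 0) (b 0) (b 1))
      (3 * T (b 0) (b 1) (b 1)) (T (b 1) (b 1) (b 1))
    refine smoothAll hW T hT hns (o := c • b 0 + a • b 1) ?_ ?_
    · intro h
      have p := congrArg (fun v => b.repr v 0) h
      have q := congrArg (fun v => b.repr v 1) h
      simp at p q
      simp [p, q] at hac
    · rw [exp2 hT]; linear_combination hr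
  · push Not at hns
    obtain ⟨o, ho0, ho⟩ := hns
    exact singAll hW T hT ho0 ho

theorem main (F : MvPolynomial (Fin 5) ℂ) (hF : F.IsHomogeneous 3) :
    IsPf (fun v => MvPolynomial.eval v F) := by
  obtain ⟨T, hT, h⟩ := exists_T F hF
  have := all (by simp) T hT
  simpa only [h] using this

end CubicPf

open MvPolynomial Matrix

/-- Every cubic form in 5 variables over ℂ admits a Pfaffian representation:
there is a 6×6 skew-symmetric matrix of linear forms whose determinant is `F ^ 2`. -/
theorem cubic_threefold_pfaffian
    (F : MvPolynomial (Fin 5) ℂ) (hF : F.IsHomogeneous 3) :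
    ∃ M : Matrix (Fin 6) (Fin 6) (MvPolynomial (Fin 5) ℂ),
      (∀ i j, (M i j).IsHomogeneous 1) ∧ Mᵀ = -M ∧ M.det = F ^ 2 := by
  exact CubicPf.IsPf.final F (CubicPf.main F hF)
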